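/- arXiv:1107.4736 — 2 statements merged into one kernel-verified Lean document; each statement's English description precedes it below -/
import Mathlib

section
/- Let T be a finite branch expanding Markov map (i.e. the index set A is finite) with repeller Λ, and let φ : Λ → ℝ be a non-negative potential satisfying the tempered distortion condition. Then for all y ∈ closure(Λ), dim D_y(φ) = s(φ). -/
open Set Filter Topology

/-- An expanding Markov map with countably many inverse branches: a countable family
`{V i}` of pairwise disjoint subintervals of `[0,1]` with nonempty interior, and a map `T`
(given here as a global function `ℝ → ℝ`, only its behaviour on `⋃ i, V i` matters) which is
`C¹` on each `V i` with derivative `T'`, maps the interior of each `V i` onto `(0,1)`, is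
uniformly expanding, and has tempered distortion of the derivative. -/
structure ExpandingMarkovMap (A : Type) : Type where
  countable : Countable A
  nontriv : ∃ i j : A, i ≠ j
  V : A → Set ℝ
  T : ℝ → ℝ
  T' : ℝ → ℝ
  V_subset : ∀ i, V i ⊆ Icc (0:ℝ) 1
  V_ordConnected : ∀ i, (V i).OrdConnected
  V_interior_nonempty : ∀ i, (interior (V i)).Nonempty
  V_disjoint : Pairwise (Function.onFun Disjoint V)
  T_mapsTo : ∀ i, MapsTo T (V i) (Icc (0:ℝ) 1)
  T_C1 : ∀ i, ContDiffOn ℝ 1 T (V i)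
  T_hasDeriv : ∀ i, ∀ x ∈ V i, HasDerivWithinAt T (T' x) (V i) x
  T_maps_interior : ∀ i, T '' interior (V i) = Ioo (0:ℝ) 1
  expanding : ∃ ξ > (1:ℝ), ∃ N : ℕ, ∀ n, N ≤ n → ∀ ω : Fin n → A, ∀ x : ℝ,
    (∀ ν : Fin n, T^[(ν : ℕ)] x ∈ V (ω ν)) →
    ξ ^ n < ∏ l ∈ Finset.range n, |T' (T^[l] x)|
  distortion : ∃ ρ : ℕ → ℝ, Tendsto ρ atTop (𝓝 0) ∧
    ∀ n : ℕ, ∀ ω : Fin n → A, ∀ x y : ℝ,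
      (∀ ν : Fin n, T^[(ν : ℕ)] x ∈ V (ω ν)) → (∀ ν : Fin n, T^[(ν : ℕ)] y ∈ V (ω ν)) →
      Real.exp (-(n : ℝ) * ρ n) ≤
          (∏ l ∈ Finset.range n, |T' (T^[l] x)|) / (∏ l ∈ Finset.range n, |T' (T^[l] y)|) ∧
        (∏ l ∈ Finset.range n, |T' (T^[l] x)|) / (∏ l ∈ Finset.range n, |T' (T^[l] y)|) ≤
          Real.exp ((n : ℝ) * ρ n)

namespace ExpandingMarkovMap

variable {A : Type} (M : ExpandingMarkovMap A)

/-- The cylinder `V_ω = ⋂_{ν<n} T^{-ν}(V_{ω_ν})` associated to a word `ω ∈ A^n`. -/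
def cylinder {n : ℕ} (ω : Fin n → A) : Set ℝ :=
  {x | ∀ ν : Fin n, M.T^[(ν : ℕ)] x ∈ M.V (ω ν)}

/-- The repeller `Λ`: the set of points all of whose iterates are well defined. -/
def repeller : Set ℝ := {x | ∀ n : ℕ, M.T^[n] x ∈ ⋃ i, M.V i}

/-- The Birkhoff sum `S_n(f)(x) = ∑_{l<n} f(T^l x)`. -/
def birkhoff (f : ℝ → ℝ) (n : ℕ) (x : ℝ) : ℝ := ∑ l ∈ Finset.range n, f (M.T^[l] x)

/-- `S_n(f)(ω) = sup { S_n(f)(x) : x ∈ V_ω }` (`f` being a potential on `Λ`). -/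
noncomputable def birkhoffSup (f : ℝ → ℝ) {n : ℕ} (ω : Fin n → A) : ℝ :=
  sSup {v | ∃ x ∈ M.cylinder ω ∩ M.repeller, v = M.birkhoff f n x}

/-- The set of values `|f x - f y|` over pairs `x, y` in a common `n`-cylinder. -/
def varSet (f : ℝ → ℝ) (n : ℕ) : Set ℝ :=
  {d | ∃ ω : Fin n → A, ∃ x ∈ M.cylinder ω ∩ M.repeller, ∃ y ∈ M.cylinder ω ∩ M.repeller,
    d = |f x - f y|}

/-- The `n`-th level variation `var_n(f)`. -/
noncomputable def var (f : ℝ → ℝ) (n : ℕ) : ℝ := sSup (M.varSet f n)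

/-- The tempered distortion condition for a potential on `Λ`:
`var_1(f) < ∞` and `n⁻¹ var_n(S_n(f)) → 0`. -/
def Tempered (f : ℝ → ℝ) : Prop :=
  BddAbove (M.varSet f 1) ∧
    Tendsto (fun n : ℕ => M.var (M.birkhoff f n) n / (n : ℝ)) atTop (𝓝 0)

/-- The topological pressure `P(f) = lim_n n⁻¹ log ∑_{ω ∈ Aⁿ} exp S_n(f)(ω)`
(realised as a `limsup` in `EReal`; the limit exists for tempered potentials). -/
noncomputable def pressure (f : ℝ → ℝ) : EReal :=
  limsup (fun n : ℕ =>
    ((1 / (n : ℝ) : ℝ) : EReal) *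
      ENNReal.log (∑' ω : Fin n → A, ENNReal.ofReal (Real.exp (M.birkhoffSup f ω)))) atTop

/-- The potential `ψ = log |T'|`. -/
noncomputable def psi : ℝ → ℝ := fun x => Real.log |M.T' x|

/-- `s(φ) = inf { s : P(-s(ψ+φ)) ≤ 0 }`. -/
noncomputable def sdim (φ : ℝ → ℝ) : ℝ :=
  sInf {s : ℝ | M.pressure (fun x => -s * (M.psi x + φ x)) ≤ 0}

/-- The shrinking target set `D_y(φ)`. -/
def shrinkingTarget (y : ℝ) (φ : ℝ → ℝ) : Set ℝ :=
  ⋂ m : ℕ, ⋃ n : ℕ, ⋃ _ : m ≤ n,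
    {x | x ∈ M.repeller ∧ |M.T^[n] x - y| < Real.exp (-(M.birkhoff φ n x))}

/-- The shrinking target set `S_y(Φ)` for a sequence of radii `Φ`. -/
def shrinkingTargetSeq (y : ℝ) (Φ : ℕ → ℝ) : Set ℝ :=
  ⋂ m : ℕ, ⋃ n : ℕ, ⋃ _ : m ≤ n, {x | x ∈ M.repeller ∧ |M.T^[n] x - y| < Φ n}

/-- `g` is the iterated function system associated to `M`: `g i` is the inverse branch of
`T` on `V i`, a `C¹` map of `[0,1]` into `closure (V i)` with `g i (T x) = x` on `V i`. -/
def IsIFS (g : A → ℝ → ℝ) : Prop :=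
  ∀ i, ContDiffOn ℝ 1 (g i) (Icc (0:ℝ) 1) ∧ MapsTo (g i) (Icc (0:ℝ) 1) (closure (M.V i)) ∧
    ∀ x ∈ M.V i, g i (M.T x) = x

end ExpandingMarkovMap

/-- The composition `φ_τ = φ_{τ_1} ∘ ⋯ ∘ φ_{τ_n}` of the maps of an IFS along a word `τ`. -/
def ifsWord {A : Type} (g : A → ℝ → ℝ) {n : ℕ} (τ : Fin n → A) : ℝ → ℝ :=
  (List.ofFn fun ν : Fin n => g (τ ν)).foldr (· ∘ ·) id

/-- `C(y,n,r)`: the collection of cylinder sets `φ_τ([0,1])`, `τ ∈ Aⁿ`, contained in `B(y,r)`. -/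
def cylinderFamily {A : Type} (g : A → ℝ → ℝ) (y : ℝ) (n : ℕ) (r : ℝ) : Set (Set ℝ) :=
  {S | ∃ τ : Fin n → A, S = ifsWord g τ '' Icc (0:ℝ) 1 ∧ S ⊆ Metric.ball y r}

/-- Positive upper cylinder density of the IFS `g` at `y`. -/
def HasPUCD {A : Type} (g : A → ℝ → ℝ) (y : ℝ) : Prop :=
  ∃ lam : ℝ → ℕ,
    Tendsto lam (𝓝[>] (0:ℝ)) atTop ∧
    limsup (fun r : ℝ => Real.log r / (lam r : ℝ)) (𝓝[>] (0:ℝ)) < 0 ∧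
    0 < limsup (fun r : ℝ =>
        (ENNReal.ofReal r)⁻¹ * ∑' S : cylinderFamily g y (lam r) r, EMetric.diam (S : Set ℝ))
      (𝓝[>] (0:ℝ))

namespace ExpandingMarkovMap

variable {A : Type} (M : ExpandingMarkovMap A)

/-- The cylinder in `[0,1]` of a word given as a list of symbols. -/
def cyl : List A → Set ℝ
  | [] => Icc 0 1
  | i :: u => {x | x ∈ M.V i ∧ M.T x ∈ cyl u}

lemma cyl_subset_Icc : ∀ u : List A, M.cyl u ⊆ Icc 0 1
  | [] => subset_rfl
  | i :: _ => fun _ hx => M.V_subset i hx.1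

lemma mem_cyl_append (u w : List A) (x : ℝ) :
    x ∈ M.cyl (u ++ w) ↔ x ∈ M.cyl u ∧ M.T^[u.length] x ∈ M.cyl w := by
  induction u generalizing x with
  | nil => exact ⟨fun h => ⟨M.cyl_subset_Icc w h, h⟩, fun h => h.2⟩
  | cons i u ih =>
    simp only [List.cons_append, cyl, mem_ofPred_eq, ih, List.length_cons,
      Function.iterate_succ_apply, and_assoc]

lemma cyl_append_subset (u w : List A) : M.cyl (u ++ w) ⊆ M.cyl u :=
  fun x hx => ((M.mem_cyl_append u w x).1 hx).1

lemma mem_cyl_ofFn {n : ℕ} (ω : Fin n → A) (x : ℝ) :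
    x ∈ M.cyl (List.ofFn ω) ↔ x ∈ Icc (0 : ℝ) 1 ∧ x ∈ M.cylinder ω := by
  induction n generalizing x with
  | zero => simp [cyl, cylinder]
  | succ n ih =>
    have h := ih (fun k => ω k.succ) (M.T x)
    simp only [List.ofFn_succ, cyl, mem_ofPred_eq, h]
    simp only [cylinder, mem_ofPred_eq, Fin.forall_fin_succ, Fin.val_zero, Function.iterate_zero,
      id_eq, Fin.val_succ, Function.iterate_succ_apply]
    exact ⟨fun h => ⟨M.V_subset _ h.1, h.1, h.2.2⟩, fun h => ⟨h.2.1, M.T_mapsTo _ h.2.1, h.2.2⟩⟩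

lemma repeller_subset_Icc : M.repeller ⊆ Icc 0 1 := fun x hx => by
  obtain ⟨i, hi⟩ := mem_iUnion.1 (hx 0)
  exact M.V_subset i hi

lemma iterate_mem_repeller {x : ℝ} (hx : x ∈ M.repeller) (n : ℕ) : M.T^[n] x ∈ M.repeller :=
  fun k => by
    rw [← Function.iterate_add_apply]
    exact hx _

lemma mem_repeller_of_cyl {x : ℝ} (h : ∀ n, ∃ u : List A, n < u.length ∧ x ∈ M.cyl u) :
    x ∈ M.repeller := fun n => by
  obtain ⟨u, hu, hx⟩ := h n
  obtain ⟨m, ω, rfl⟩ : ∃ m, ∃ ω : Fin m → A, u = List.ofFn ω := ⟨_, u.get, (List.ofFn_get u).symm⟩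
  rw [List.length_ofFn] at hu
  exact mem_iUnion.2 ⟨_, ((M.mem_cyl_ofFn ω x).1 hx).2 ⟨n, hu⟩⟩

lemma mem_iUnion_of_mem_cyl {u : List A} {x : ℝ} (hx : x ∈ M.cyl u) {l : ℕ} (hl : l < u.length) :
    ∃ i, M.T^[l] x ∈ M.V i := by
  obtain ⟨m, ω, rfl⟩ : ∃ m, ∃ ω : Fin m → A, u = List.ofFn ω := ⟨_, u.get, (List.ofFn_get u).symm⟩
  rw [List.length_ofFn] at hl
  exact ⟨_, ((M.mem_cyl_ofFn ω x).1 hx).2 ⟨l, hl⟩⟩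

lemma disjoint_cyl : ∀ u v : List A, u.length = v.length → u ≠ v → Disjoint (M.cyl u) (M.cyl v)
  | [], [], _, h => absurd rfl h
  | [], _ :: _, h, _ => by simp at h
  | _ :: _, [], h, _ => by simp at h
  | i :: u, j :: v, h, hne => by
    rw [Set.disjoint_left]
    intro x hx hx'
    by_cases hij : i = j
    · subst hij
      exact Set.disjoint_left.1 (disjoint_cyl u v (by simpa using h) (by simpa using hne)) hx.2 hx'.2
    · exact Set.disjoint_left.1 (M.V_disjoint hij) hx.1 hx'.1

lemma deriv_ne_zero {i : A} {x : ℝ} (hx : x ∈ M.V i) : M.T' x ≠ 0 := by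
  obtain ⟨ρ, -, h⟩ := M.distortion
  intro h0
  have h1 := (h 1 (fun _ => i) x x (by simpa using hx) (by simpa using hx)).1
  simp only [Finset.prod_range_one, Function.iterate_zero, id_eq, h0, abs_zero, div_zero] at h1
  exact absurd h1 (not_le.2 (Real.exp_pos _))

lemma strictMonoOn_or_strictAntiOn_V (i : A) :
    StrictMonoOn M.T (M.V i) ∨ StrictAntiOn M.T (M.V i) := by
  have hc : Convex ℝ (M.V i) := (M.V_ordConnected i).convex
  have hcont : ContinuousOn M.T (M.V i) := (M.T_C1 i).continuousOn
  have hd : ∀ x ∈ interior (M.V i), deriv M.T x = M.T' x := fun x hx =>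
    ((M.T_hasDeriv i x (interior_subset hx)).hasDerivAt (mem_interior_iff_mem_nhds.1 hx)).deriv
  rcases hasDerivWithinAt_forall_lt_or_forall_gt_of_forall_ne hc (M.T_hasDeriv i)
    (fun x hx => M.deriv_ne_zero hx) with h | h
  · exact Or.inr (strictAntiOn_of_deriv_neg hc hcont fun x hx => by
      rw [hd x hx]; exact h x (interior_subset hx))
  · exact Or.inl (strictMonoOn_of_deriv_pos hc hcont fun x hx => by
      rw [hd x hx]; exact h x (interior_subset hx))

lemma strictMonoOn_or_strictAntiOn_cyl (u : List A) :
    StrictMonoOn M.T^[u.length] (M.cyl u) ∨ StrictAntiOn M.T^[u.length] (M.cyl u) := by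
  induction u with
  | nil => exact Or.inl fun x _ y _ h => h
  | cons i u ih =>
    have hsub : M.cyl (i :: u) ⊆ M.V i := fun x hx => hx.1
    have hm : MapsTo M.T (M.cyl (i :: u)) (M.cyl u) := fun x hx => hx.2
    simp only [List.length_cons, Function.iterate_succ]
    rcases M.strictMonoOn_or_strictAntiOn_V i with h | h <;> rcases ih with h' | h'
    · exact Or.inl (h'.comp (h.mono hsub) hm)
    · exact Or.inr (h'.comp_strictMonoOn (h.mono hsub) hm)
    · exact Or.inr (h'.comp_strictAntiOn (h.mono hsub) hm)
    · exact Or.inl (h'.comp (h.mono hsub) hm)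

lemma ordConnected_cyl (u : List A) : (M.cyl u).OrdConnected := by
  induction u with
  | nil => exact ordConnected_Icc
  | cons i u ih =>
    refine ⟨fun x hx y hy z hz => ?_⟩
    have hzV : z ∈ M.V i := (M.V_ordConnected i).out hx.1 hy.1 hz
    refine ⟨hzV, ?_⟩
    rcases M.strictMonoOn_or_strictAntiOn_V i with h | h
    · exact ih.out hx.2 hy.2 ⟨h.monotoneOn hx.1 hzV hz.1, h.monotoneOn hzV hy.1 hz.2⟩
    · exact ih.out hy.2 hx.2 ⟨h.antitoneOn hzV hy.1 hz.2, h.antitoneOn hx.1 hzV hz.1⟩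

lemma hasDerivWithinAt_iterate_cyl (u : List A) {x : ℝ} (hx : x ∈ M.cyl u) :
    HasDerivWithinAt M.T^[u.length] (∏ l ∈ Finset.range u.length, M.T' (M.T^[l] x))
      (M.cyl u) x := by
  induction u generalizing x with
  | nil => simpa using hasDerivWithinAt_id x (M.cyl [])
  | cons i u ih =>
    have hsub : M.cyl (i :: u) ⊆ M.V i := fun x hx => hx.1
    have hm : MapsTo M.T (M.cyl (i :: u)) (M.cyl u) := fun x hx => hx.2
    have h := (ih hx.2).comp x ((M.T_hasDeriv i x hx.1).mono hsub) hm
    rw [List.length_cons, Function.iterate_succ, Finset.prod_range_succ']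
    simpa [Function.iterate_succ_apply] using h

lemma exp_birkhoff_psi {u : List A} {x : ℝ} (hx : x ∈ M.cyl u) :
    Real.exp (M.birkhoff M.psi u.length x) = ∏ l ∈ Finset.range u.length, |M.T' (M.T^[l] x)| := by
  rw [birkhoff, Real.exp_sum]
  refine Finset.prod_congr rfl fun l hl => ?_
  obtain ⟨i, hi⟩ := M.mem_iUnion_of_mem_cyl hx (Finset.mem_range.1 hl)
  exact Real.exp_log (abs_pos.2 (M.deriv_ne_zero hi))

lemma exists_slope (u : List A) {x y : ℝ} (hx : x ∈ M.cyl u) (hy : y ∈ M.cyl u) :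
    ∃ z ∈ M.cyl u, |M.T^[u.length] x - M.T^[u.length] y| =
      Real.exp (M.birkhoff M.psi u.length z) * |x - y| := by
  wlog hxy : x < y generalizing x y
  · rcases (not_lt.1 hxy).eq_or_lt with h | h
    · exact ⟨x, hx, by simp [h]⟩
    · obtain ⟨z, hz, h⟩ := this hy hx h
      exact ⟨z, hz, by rw [abs_sub_comm, h, abs_sub_comm]⟩
  have hsub : Icc x y ⊆ M.cyl u := (M.ordConnected_cyl u).out hx hy
  obtain ⟨z, hz, h⟩ := exists_hasDerivAt_eq_slope M.T^[u.length]
    (fun z => ∏ l ∈ Finset.range u.length, M.T' (M.T^[l] z)) hxy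
    (fun z hz => (M.hasDerivWithinAt_iterate_cyl u (hsub hz)).continuousWithinAt.mono hsub)
    (fun z hz => ((M.hasDerivWithinAt_iterate_cyl u (hsub (Ioo_subset_Icc_self hz))).mono
      hsub).hasDerivAt (Icc_mem_nhds hz.1 hz.2))
  have hzc := hsub (Ioo_subset_Icc_self hz)
  refine ⟨z, hzc, ?_⟩
  rw [M.exp_birkhoff_psi hzc, ← Finset.abs_prod, h, ← abs_mul, abs_sub_comm,
    ← abs_neg (_ / _ * _)]
  congr 1
  have : y - x ≠ 0 := (sub_pos.2 hxy).ne'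
  field_simp
  ring

lemma birkhoff_add (f : ℝ → ℝ) (n m : ℕ) (x : ℝ) :
    M.birkhoff f (n + m) x = M.birkhoff f n x + M.birkhoff f m (M.T^[n] x) := by
  simp only [birkhoff, Finset.sum_range_add, ← Function.iterate_add_apply]
  congr 1
  refine Finset.sum_congr rfl fun l _ => by rw [add_comm]

lemma exists_preimage (u : List A) {t : ℝ} (ht : t ∈ Ioo (0 : ℝ) 1) :
    ∃ x ∈ M.cyl u, x ∈ Ioo (0 : ℝ) 1 ∧ M.T^[u.length] x = t := by
  induction u with
  | nil => exact ⟨t, Ioo_subset_Icc_self ht, ht, rfl⟩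
  | cons i u ih =>
    obtain ⟨x', hx', h01, h⟩ := ih
    rw [← M.T_maps_interior i] at h01
    obtain ⟨x, hx, rfl⟩ := h01
    refine ⟨x, ⟨interior_subset hx, hx'⟩, ?_, ?_⟩
    · have := interior_mono (M.V_subset i) hx
      rwa [interior_Icc] at this
    · rw [List.length_cons, Function.iterate_succ_apply, h]

end ExpandingMarkovMap

namespace ExpandingMarkovMap

variable {A : Type} (M : ExpandingMarkovMap A)

lemma exists_uniform_bound {A : Type} [Finite A] {f : ℝ → ℝ} {S : A → Set ℝ} {K : ℝ}
    (h : ∀ i, ∀ x ∈ S i, ∀ y ∈ S i, |f x - f y| ≤ K) :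
    ∃ B, 0 ≤ B ∧ ∀ i, ∀ x ∈ S i, |f x| ≤ B := by
  have h1 : ∀ i, ∃ B, ∀ x ∈ S i, |f x| ≤ B := fun i => by
    rcases (S i).eq_empty_or_nonempty with h0 | ⟨y, hy⟩
    · exact ⟨0, by simp [h0]⟩
    · refine ⟨|f y| + K, fun x hx => ?_⟩
      have h2 := h i x hx y hy
      have h3 := abs_sub_abs_le_abs_sub (f x) (f y)
      linarith
  choose b hb using h1
  obtain ⟨B, hB⟩ := Set.Finite.bddAbove (Set.finite_range b)
  exact ⟨max B 0, le_max_right _ _, fun i x hx =>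
    (hb i x hx).trans ((hB ⟨i, rfl⟩).trans (le_max_left _ _))⟩

lemma birkhoff_abs_le {f : ℝ → ℝ} {B : ℝ} {n : ℕ} {x : ℝ}
    (h : ∀ l < n, |f (M.T^[l] x)| ≤ B) : |M.birkhoff f n x| ≤ n * B := by
  refine (Finset.abs_sum_le_sum_abs _ _).trans ?_
  refine (Finset.sum_le_sum fun l hl => h l (Finset.mem_range.1 hl)).trans ?_
  simp

/-- Uniform bounds for an expanding Markov map with finitely many branches and a tempered
potential `φ`: `R` controls the distortion of the Birkhoff sums of `ψ` and `φ`. -/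
structure Bounds (φ : ℝ → ℝ) where
  B : ℝ
  R : ℕ → ℝ
  θ : ℝ
  c : ℝ
  B_nonneg : 0 ≤ B
  psi_le : ∀ i, ∀ x ∈ M.V i, |M.psi x| ≤ B
  phi_le : ∀ x ∈ M.repeller, |φ x| ≤ B
  R_nonneg : ∀ n, 0 ≤ R n
  R_small : ∀ ε > 0, ∃ C, 0 ≤ C ∧ ∀ n : ℕ, R n ≤ ε * n + C
  psi_dist : ∀ u : List A, ∀ x ∈ M.cyl u, ∀ y ∈ M.cyl u,
    |M.birkhoff M.psi u.length x - M.birkhoff M.psi u.length y| ≤ R u.length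
  phi_dist : ∀ u : List A, ∀ x ∈ M.cyl u ∩ M.repeller, ∀ y ∈ M.cyl u ∩ M.repeller,
    |M.birkhoff φ u.length x - M.birkhoff φ u.length y| ≤ R u.length
  θ_pos : 0 < θ
  c_nonneg : 0 ≤ c
  expand : ∀ u : List A, ∀ x ∈ M.cyl u, θ * u.length - c ≤ M.birkhoff M.psi u.length x

lemma exists_le_mul_add {R : ℕ → ℝ} (h : Tendsto (fun n : ℕ => R n / n) atTop (𝓝 0)) {ε : ℝ}
    (hε : 0 < ε) : ∃ C, 0 ≤ C ∧ ∀ n : ℕ, R n ≤ ε * n + C := by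
  obtain ⟨N, hN⟩ := eventually_atTop.1 (h.eventually (gt_mem_nhds hε))
  refine ⟨∑ n ∈ Finset.range (N + 1), |R n|, Finset.sum_nonneg fun _ _ => abs_nonneg _,
    fun n => ?_⟩
  by_cases hn : n < N + 1
  · have h1 := Finset.single_le_sum (f := fun n => |R n|) (fun _ _ => abs_nonneg _)
      (Finset.mem_range.2 hn)
    have h2 := le_abs_self (R n)
    have h3 : 0 ≤ ε * n := by positivity
    linarith
  · have h1 := hN n (by omega)
    have hn0 : (0 : ℝ) < n := by exact_mod_cast (by omega : 0 < n)
    have h2 := (div_lt_iff₀ hn0).1 h1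
    have h3 : 0 ≤ ∑ n ∈ Finset.range (N + 1), |R n| := Finset.sum_nonneg fun _ _ => abs_nonneg _
    linarith

lemma exists_distortion : ∃ ρ : ℕ → ℝ, Tendsto ρ atTop (𝓝 0) ∧ ∀ u : List A,
    ∀ x ∈ M.cyl u, ∀ y ∈ M.cyl u,
      |M.birkhoff M.psi u.length x - M.birkhoff M.psi u.length y| ≤ u.length * |ρ u.length| := by
  obtain ⟨ρ, hρ, h⟩ := M.distortion
  refine ⟨ρ, hρ, fun u x hx y hy => ?_⟩
  have hx' := M.exp_birkhoff_psi hx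
  have hy' := M.exp_birkhoff_psi hy
  obtain ⟨m, ω, rfl⟩ : ∃ m, ∃ ω : Fin m → A, u = List.ofFn ω := ⟨_, u.get, (List.ofFn_get u).symm⟩
  have h1 := h m ω x y ((M.mem_cyl_ofFn ω x).1 hx).2 ((M.mem_cyl_ofFn ω y).1 hy).2
  rw [List.length_ofFn] at *
  rw [← hx', ← hy', ← Real.exp_sub, Real.exp_le_exp, Real.exp_le_exp] at h1
  have h2 : (m : ℝ) * ρ m ≤ m * |ρ m| := mul_le_mul_of_nonneg_left (le_abs_self _) (by positivity)
  rw [abs_le]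
  constructor <;> linarith [h1.1, h1.2]

lemma exists_psi_bound [Finite A] :
    ∃ B, 0 ≤ B ∧ ∀ i, ∀ x ∈ M.V i, |M.psi x| ≤ B := by
  obtain ⟨ρ, -, h⟩ := M.exists_distortion
  refine exists_uniform_bound (K := |ρ 1|) fun i x hx y hy => ?_
  simpa [birkhoff] using h [i] x ⟨hx, M.T_mapsTo i hx⟩ y ⟨hy, M.T_mapsTo i hy⟩

lemma exists_phi_bound [Finite A] {φ : ℝ → ℝ} (hφ : M.Tempered φ) :
    ∃ B, 0 ≤ B ∧ ∀ x ∈ M.repeller, |φ x| ≤ B := by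
  obtain ⟨K, hK⟩ := hφ.1
  obtain ⟨B, hB0, hB⟩ := exists_uniform_bound (S := fun i => M.V i ∩ M.repeller) (f := φ) (K := K)
    fun i x hx y hy => hK ⟨fun _ => i, x, ⟨by simpa [cylinder] using hx.1, hx.2⟩, y,
      ⟨by simpa [cylinder] using hy.1, hy.2⟩, rfl⟩
  refine ⟨B, hB0, fun x hx => ?_⟩
  obtain ⟨i, hi⟩ := mem_iUnion.1 (hx 0)
  exact hB i x ⟨hi, hx⟩

lemma birkhoff_phi_dist {φ : ℝ → ℝ} {B : ℝ} (hB : ∀ x ∈ M.repeller, |φ x| ≤ B) (u : List A)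
    {x y : ℝ} (hx : x ∈ M.cyl u ∩ M.repeller) (hy : y ∈ M.cyl u ∩ M.repeller) :
    |M.birkhoff φ u.length x - M.birkhoff φ u.length y| ≤
      M.var (M.birkhoff φ u.length) u.length := by
  obtain ⟨m, ω, rfl⟩ : ∃ m, ∃ ω : Fin m → A, u = List.ofFn ω := ⟨_, u.get, (List.ofFn_get u).symm⟩
  rw [List.length_ofFn]
  refine le_csSup ⟨m * B + m * B, ?_⟩ ⟨ω, x, ⟨((M.mem_cyl_ofFn ω x).1 hx.1).2, hx.2⟩, y,
    ⟨((M.mem_cyl_ofFn ω y).1 hy.1).2, hy.2⟩, rfl⟩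
  rintro _ ⟨_, a, ha, b, hb, rfl⟩
  exact (abs_sub _ _).trans (add_le_add
    (M.birkhoff_abs_le fun l _ => hB _ (M.iterate_mem_repeller ha.2 l))
    (M.birkhoff_abs_le fun l _ => hB _ (M.iterate_mem_repeller hb.2 l)))

lemma exists_expand {B : ℝ} (hB : ∀ i, ∀ x ∈ M.V i, |M.psi x| ≤ B) (hB0 : 0 ≤ B) :
    ∃ θ c : ℝ, 0 < θ ∧ 0 ≤ c ∧ ∀ u : List A, ∀ x ∈ M.cyl u,
      θ * u.length - c ≤ M.birkhoff M.psi u.length x := by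
  obtain ⟨ξ, hξ, N, h⟩ := M.expanding
  have hlog : 0 < Real.log ξ := Real.log_pos hξ
  refine ⟨Real.log ξ, (Real.log ξ + B) * N, hlog, by positivity, fun u x hx => ?_⟩
  rcases le_or_gt N u.length with hN | hN
  · have hx' := M.exp_birkhoff_psi hx
    have : ξ ^ u.length < Real.exp (M.birkhoff M.psi u.length x) := by
      rw [hx']
      obtain ⟨m, ω, rfl⟩ : ∃ m, ∃ ω : Fin m → A, u = List.ofFn ω :=
        ⟨_, u.get, (List.ofFn_get u).symm⟩
      rw [List.length_ofFn] at *
      exact h m hN ω x ((M.mem_cyl_ofFn ω x).1 hx).2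
    have h1 := Real.log_lt_log (by positivity) this
    rw [Real.log_exp, Real.log_pow] at h1
    have : 0 ≤ (Real.log ξ + B) * N := by positivity
    linarith
  · have h1 := M.birkhoff_abs_le (f := M.psi) (B := B) (n := u.length) (x := x) fun l hl => by
      obtain ⟨i, hi⟩ := M.mem_iUnion_of_mem_cyl hx hl
      exact hB i _ hi
    have h2 := (abs_le.1 h1).1
    have h3 : (u.length : ℝ) ≤ N := by exact_mod_cast hN.le
    nlinarith

lemma exists_bounds [Finite A] {φ : ℝ → ℝ} (hφ : M.Tempered φ) : Nonempty (M.Bounds φ) := by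
  obtain ⟨B₁, hB₁0, hB₁⟩ := M.exists_psi_bound
  obtain ⟨B₂, hB₂0, hB₂⟩ := M.exists_phi_bound hφ
  obtain ⟨ρ, hρ, hd⟩ := M.exists_distortion
  obtain ⟨θ, c, hθ, hc, he⟩ := M.exists_expand hB₁ hB₁0
  have ht : Tendsto (fun n : ℕ => (n * |ρ n| + |M.var (M.birkhoff φ n) n|) / n) atTop (𝓝 0) := by
    have h1 : Tendsto (fun n : ℕ => |ρ n| + |M.var (M.birkhoff φ n) n / n|) atTop (𝓝 0) := by
      simpa using hρ.abs.add hφ.2.abs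
    refine h1.congr' ?_
    filter_upwards [eventually_gt_atTop 0] with n hn
    have hn : (0 : ℝ) < n := by exact_mod_cast hn
    rw [abs_div, abs_of_pos hn]
    field_simp
  exact ⟨{
    B := max B₁ B₂
    R := fun n => n * |ρ n| + |M.var (M.birkhoff φ n) n|
    θ := θ
    c := c
    B_nonneg := hB₁0.trans (le_max_left _ _)
    psi_le := fun i x hx => (hB₁ i x hx).trans (le_max_left _ _)
    phi_le := fun x hx => (hB₂ x hx).trans (le_max_right _ _)
    R_nonneg := fun n => by positivity
    R_small := fun ε hε => exists_le_mul_add ht hε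
    psi_dist := fun u x hx y hy => (hd u x hx y hy).trans (le_add_of_nonneg_right (abs_nonneg _))
    phi_dist := fun u x hx y hy => ((M.birkhoff_phi_dist hB₂ u hx hy).trans (le_abs_self _)).trans
      (le_add_of_nonneg_left (by positivity))
    θ_pos := hθ
    c_nonneg := hc
    expand := he }⟩

lemma iterate_mem_Icc {u : List A} {x : ℝ} (hx : x ∈ M.cyl u) :
    M.T^[u.length] x ∈ Icc (0 : ℝ) 1 :=
  ((M.mem_cyl_append u [] x).1 (by simpa using hx)).2

namespace Bounds

variable {M} {φ : ℝ → ℝ} (e : M.Bounds φ)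

lemma abs_sub_le {u : List A} {x y z : ℝ} (hx : x ∈ M.cyl u) (hy : y ∈ M.cyl u)
    (hz : z ∈ M.cyl u) : |x - y| ≤ Real.exp (e.R u.length - M.birkhoff M.psi u.length z) *
      |M.T^[u.length] x - M.T^[u.length] y| := by
  obtain ⟨w, hw, h⟩ := M.exists_slope u hx hy
  rw [h, ← mul_assoc, ← Real.exp_add]
  have h1 := (abs_le.1 (e.psi_dist u w hw z hz)).1
  exact le_mul_of_one_le_left (abs_nonneg _) (Real.one_le_exp (by linarith))

lemma abs_iterate_sub_le {u : List A} {x y z : ℝ} (hx : x ∈ M.cyl u) (hy : y ∈ M.cyl u)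
    (hz : z ∈ M.cyl u) : |M.T^[u.length] x - M.T^[u.length] y| ≤
      Real.exp (e.R u.length + M.birkhoff M.psi u.length z) * |x - y| := by
  obtain ⟨w, hw, h⟩ := M.exists_slope u hx hy
  rw [h]
  have h1 := (abs_le.1 (e.psi_dist u w hw z hz)).2
  exact mul_le_mul_of_nonneg_right (Real.exp_le_exp.2 (by linarith)) (abs_nonneg _)

lemma abs_psi_le {u : List A} {x : ℝ} (hx : x ∈ M.cyl u) :
    |M.birkhoff M.psi u.length x| ≤ u.length * e.B :=
  M.birkhoff_abs_le fun l hl => by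
    obtain ⟨i, hi⟩ := M.mem_iUnion_of_mem_cyl hx hl
    exact e.psi_le i _ hi

lemma abs_phi_le {x : ℝ} (hx : x ∈ M.repeller) (n : ℕ) : |M.birkhoff φ n x| ≤ n * e.B :=
  M.birkhoff_abs_le fun l _ => e.phi_le _ (M.iterate_mem_repeller hx l)

lemma abs_sub_le_exp {u : List A} {x y z : ℝ} (hx : x ∈ M.cyl u) (hy : y ∈ M.cyl u)
    (hz : z ∈ M.cyl u) :
    |x - y| ≤ Real.exp (e.R u.length - M.birkhoff M.psi u.length z) := by
  refine (e.abs_sub_le hx hy hz).trans (mul_le_of_le_one_right (Real.exp_pos _).le ?_)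
  have h1 := M.iterate_mem_Icc hx
  have h2 := M.iterate_mem_Icc hy
  exact abs_sub_le_iff.2 ⟨by linarith [h1.2, h2.1], by linarith [h2.2, h1.1]⟩

lemma exists_small (e : M.Bounds φ) {r : ℝ} (hr : 0 < r) : ∃ n₀ : ℕ, ∀ u : List A, n₀ ≤ u.length →
    ∀ x ∈ M.cyl u, ∀ y ∈ M.cyl u, |x - y| < r := by
  obtain ⟨C, hC, h⟩ := e.R_small (e.θ / 2) (half_pos e.θ_pos)
  obtain ⟨n₀, hn₀⟩ := exists_nat_gt ((C + e.c - Real.log r) / (e.θ / 2))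
  refine ⟨n₀, fun u hu x hx y hy => (e.abs_sub_le_exp hx hy hx).trans_lt ?_⟩
  rw [← Real.lt_log_iff_exp_lt hr]
  have h1 := h u.length
  have h2 := e.expand u x hx
  have h3 : (n₀ : ℝ) ≤ u.length := by exact_mod_cast hu
  rw [div_lt_iff₀ (half_pos e.θ_pos)] at hn₀
  have h4 := mul_le_mul_of_nonneg_right h3 (half_pos e.θ_pos).le
  linarith

end Bounds

lemma cyl_nonempty (u : List A) : (M.cyl u).Nonempty := by
  obtain ⟨x, hx, -⟩ := M.exists_preimage u (t := 1 / 2) (by norm_num)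
  exact ⟨x, hx⟩

lemma exists_inner_word : ∃ κ : List A, 0 < κ.length ∧ ∃ a b : ℝ, 0 < a ∧ a < b ∧ b < 1 ∧
    M.cyl κ ⊆ Icc a b := by
  obtain ⟨i, j, hij⟩ := M.nontriv
  have key : ∀ u v w : List A, Disjoint (M.cyl u) (M.cyl v) → Disjoint (M.cyl v) (M.cyl w) →
      ∀ x ∈ M.cyl u, ∀ y ∈ M.cyl v, ∀ z ∈ M.cyl w, 0 < x → z < 1 → x < y → y < z →
      ∃ a b : ℝ, 0 < a ∧ a < b ∧ b < 1 ∧ M.cyl v ⊆ Icc a b := by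
    intro u v w huv hvw x hx y hy z hz hx0 hz1 hxy hyz
    refine ⟨x, z, hx0, hxy.trans hyz, hz1, fun t ht => ⟨?_, ?_⟩⟩
    · by_contra! h
      exact Set.disjoint_left.1 huv hx ((M.ordConnected_cyl v).out ht hy ⟨h.le, hxy.le⟩)
    · by_contra! h
      exact Set.disjoint_left.1 hvw ((M.ordConnected_cyl v).out hy ht ⟨hyz.le, h.le⟩) hz
  have h12 := M.disjoint_cyl [i, i] [i, j] rfl (by simpa using hij)
  have h13 := M.disjoint_cyl [i, i] [j, i] rfl (by simpa using hij)
  have h23 := M.disjoint_cyl [i, j] [j, i] rfl (by simp [hij])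
  obtain ⟨x, hx, hx01, -⟩ := M.exists_preimage [i, i] (t := 1 / 2) (by norm_num)
  obtain ⟨y, hy, hy01, -⟩ := M.exists_preimage [i, j] (t := 1 / 2) (by norm_num)
  obtain ⟨z, hz, hz01, -⟩ := M.exists_preimage [j, i] (t := 1 / 2) (by norm_num)
  have hxy : x ≠ y := fun h => Set.disjoint_left.1 h12 hx (h ▸ hy)
  have hxz : x ≠ z := fun h => Set.disjoint_left.1 h13 hx (h ▸ hz)
  have hyz : y ≠ z := fun h => Set.disjoint_left.1 h23 hy (h ▸ hz)
  rcases hxy.lt_or_gt with h1 | h1 <;> rcases hxz.lt_or_gt with h2 | h2 <;>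
    rcases hyz.lt_or_gt with h3 | h3
  · exact ⟨[i, j], by simp, key _ _ _ h12 h23 x hx y hy z hz hx01.1 hz01.2 h1 h3⟩
  · exact ⟨[j, i], by simp, key _ _ _ h13 h23.symm x hx z hz y hy hx01.1 hy01.2 h2 h3⟩
  · linarith
  · exact ⟨[i, i], by simp, key _ _ _ h13.symm h12 z hz x hx y hy hz01.1 hy01.2 h2 h1⟩
  · exact ⟨[i, i], by simp, key _ _ _ h12.symm h13 y hy x hx z hz hy01.1 hz01.2 h1 h2⟩
  · linarith
  · exact ⟨[j, i], by simp, key _ _ _ h23 h13.symm y hy z hz x hx hy01.1 hx01.2 h3 h2⟩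
  · exact ⟨[i, j], by simp, key _ _ _ h23.symm h12.symm z hz y hy x hx hz01.1 hx01.2 h3 h1⟩

lemma closure_cyl_append_subset {κ : List A} {a b : ℝ} (ha : 0 < a) (hab : a < b) (hb : b < 1)
    (hκ : M.cyl κ ⊆ Icc a b) (u : List A) : closure (M.cyl (u ++ κ)) ⊆ M.cyl u := by
  obtain ⟨x, hx, -, hxa⟩ := M.exists_preimage u (t := a) ⟨ha, hab.trans hb⟩
  obtain ⟨y, hy, -, hyb⟩ := M.exists_preimage u (t := b) ⟨ha.trans hab, hb⟩
  refine (closure_minimal ?_ isClosed_Icc).trans ((M.ordConnected_cyl u).uIcc_subset hx hy)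
  intro z hz
  obtain ⟨hzu, hzκ⟩ := (M.mem_cyl_append u κ z).1 hz
  have h := hκ hzκ
  rw [← hxa, ← hyb] at h
  rcases M.strictMonoOn_or_strictAntiOn_cyl u with hm | hm
  · exact ⟨inf_le_left.trans ((hm.le_iff_le hx hzu).1 h.1),
      ((hm.le_iff_le hzu hy).1 h.2).trans le_sup_right⟩
  · exact ⟨inf_le_right.trans ((hm.le_iff_ge hzu hy).1 h.2),
      ((hm.le_iff_ge hx hzu).1 h.1).trans le_sup_left⟩

lemma exists_mem_of_nested (u : ℕ → List A)
    (h : ∀ n, closure (M.cyl (u (n + 1))) ⊆ M.cyl (u n)) : ∃ x, ∀ n, x ∈ M.cyl (u n) := by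
  obtain ⟨x, hx⟩ := IsCompact.nonempty_iInter_of_sequence_nonempty_isCompact_isClosed
    (fun n => closure (M.cyl (u n))) (fun n => (h n).trans subset_closure)
    (fun n => (M.cyl_nonempty _).closure)
    (isCompact_Icc.of_isClosed_subset isClosed_closure
      (closure_minimal (M.cyl_subset_Icc _) isClosed_Icc)) (fun n => isClosed_closure)
  exact ⟨x, fun n => h n (mem_iInter.1 hx (n + 1))⟩

lemma cyl_inter_repeller_nonempty (u : List A) : (M.cyl u ∩ M.repeller).Nonempty := by
  obtain ⟨κ, hκ0, a, b, ha, hab, hb, hκ⟩ := M.exists_inner_word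
  let v : ℕ → List A := fun n => Nat.rec u (fun _ w => w ++ κ) n
  have hv : ∀ n, v (n + 1) = v n ++ κ := fun n => rfl
  obtain ⟨x, hx⟩ := M.exists_mem_of_nested v fun n => by
    rw [hv]
    exact M.closure_cyl_append_subset ha hab hb hκ _
  have hlen : ∀ n, n ≤ (v n).length := fun n => by
    induction n with
    | zero => exact Nat.zero_le _
    | succ n ih => rw [hv, List.length_append]; omega
  exact ⟨x, hx 0, M.mem_repeller_of_cyl fun n => ⟨v (n + 1), hlen (n + 1), hx (n + 1)⟩⟩

end ExpandingMarkovMap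

namespace ExpandingMarkovMap

variable {A : Type} (M : ExpandingMarkovMap A)

lemma exists_coding {x : ℝ} (hx : x ∈ M.repeller) :
    ∃ a : ℕ → A, ∀ n, x ∈ M.cyl (List.ofFn fun k : Fin n => a k) := by
  choose a ha using fun k => mem_iUnion.1 (hx k)
  exact ⟨a, fun n => (M.mem_cyl_ofFn _ _).2 ⟨M.repeller_subset_Icc hx, fun k => ha k⟩⟩

lemma birkhoff_neg_mul (φ : ℝ → ℝ) (s : ℝ) (n : ℕ) (x : ℝ) :
    M.birkhoff (fun x => -s * (M.psi x + φ x)) n x =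
      -s * (M.birkhoff M.psi n x + M.birkhoff φ n x) := by
  simp only [birkhoff, ← Finset.mul_sum, Finset.sum_add_distrib]

lemma birkhoffSup_le {f : ℝ → ℝ} {n : ℕ} {ω : Fin n → A} {b : ℝ}
    (h : ∀ x ∈ M.cyl (List.ofFn ω) ∩ M.repeller, M.birkhoff f n x ≤ b) :
    M.birkhoffSup f ω ≤ b := by
  obtain ⟨x, hx⟩ := M.cyl_inter_repeller_nonempty (List.ofFn ω)
  refine csSup_le ⟨_, x, ⟨((M.mem_cyl_ofFn ω x).1 hx.1).2, hx.2⟩, rfl⟩ ?_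
  rintro _ ⟨z, hz, rfl⟩
  exact h z ⟨(M.mem_cyl_ofFn ω z).2 ⟨M.repeller_subset_Icc hz.2, hz.1⟩, hz.2⟩

lemma Bounds.le_birkhoffSup {M : ExpandingMarkovMap A} {φ : ℝ → ℝ} (e : M.Bounds φ) (s : ℝ)
    {n : ℕ} {ω : Fin n → A} {x : ℝ} (hx : x ∈ M.cyl (List.ofFn ω) ∩ M.repeller) :
    -s * (M.birkhoff M.psi n x + M.birkhoff φ n x) ≤
      M.birkhoffSup (fun x => -s * (M.psi x + φ x)) ω := by
  rw [← M.birkhoff_neg_mul]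
  refine le_csSup ⟨|s| * (n * e.B + n * e.B), ?_⟩
    ⟨x, ⟨((M.mem_cyl_ofFn ω x).1 hx.1).2, hx.2⟩, rfl⟩
  rintro _ ⟨z, hz, rfl⟩
  rw [M.birkhoff_neg_mul]
  have h1 := e.abs_psi_le ((M.mem_cyl_ofFn ω z).2 ⟨M.repeller_subset_Icc hz.2, hz.1⟩)
  rw [List.length_ofFn] at h1
  refine (le_abs_self _).trans ?_
  rw [abs_mul, abs_neg]
  exact mul_le_mul_of_nonneg_left ((abs_add_le _ _).trans (add_le_add h1 (e.abs_phi_le hz.2 n)))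
    (abs_nonneg _)

lemma one_div_mul_lt_iff {n : ℕ} (hn : 0 < n) (L : EReal) (g : ℝ) :
    ((1 / (n : ℝ) : ℝ) : EReal) * L < g ↔ L < ((g * n : ℝ) : EReal) := by
  have hn' : (0 : ℝ) < n := by exact_mod_cast hn
  have hpos : 0 < 1 / (n : ℝ) := by positivity
  induction L with
  | bot => rw [EReal.coe_mul_bot_of_pos hpos]; simp [-EReal.coe_mul]
  | top => rw [EReal.coe_mul_top_of_pos hpos]; simp [-EReal.coe_mul]
  | coe L =>
    rw [← EReal.coe_mul, EReal.coe_lt_coe_iff, EReal.coe_lt_coe_iff, one_div, inv_mul_eq_div,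
      div_lt_iff₀ hn']

lemma lt_one_div_mul_iff {n : ℕ} (hn : 0 < n) (L : EReal) (g : ℝ) :
    (g : EReal) < ((1 / (n : ℝ) : ℝ) : EReal) * L ↔ ((g * n : ℝ) : EReal) < L := by
  have hn' : (0 : ℝ) < n := by exact_mod_cast hn
  have hpos : 0 < 1 / (n : ℝ) := by positivity
  induction L with
  | bot => rw [EReal.coe_mul_bot_of_pos hpos]; simp [-EReal.coe_mul]
  | top => rw [EReal.coe_mul_top_of_pos hpos]; simp [-EReal.coe_mul]
  | coe L =>
    rw [← EReal.coe_mul, EReal.coe_lt_coe_iff, EReal.coe_lt_coe_iff, one_div, inv_mul_eq_div,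
      lt_div_iff₀ hn']

lemma log_ofReal_exp (x : ℝ) : ENNReal.log (ENNReal.ofReal (Real.exp x)) = x := by
  rw [ENNReal.log_ofReal_of_pos (Real.exp_pos x), Real.log_exp]

lemma eventually_sum_lt_of_pressure_le {f : ℝ → ℝ} (h : M.pressure f ≤ 0) {γ : ℝ} (hγ : 0 < γ) :
    ∀ᶠ n : ℕ in atTop, ∑' ω : Fin n → A, ENNReal.ofReal (Real.exp (M.birkhoffSup f ω)) <
      ENNReal.ofReal (Real.exp (γ * n)) := by
  have h1 : M.pressure f < (γ : EReal) := h.trans_lt (by exact_mod_cast hγ)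
  filter_upwards [eventually_lt_of_limsup_lt h1, eventually_gt_atTop 0] with n hn hn0
  rw [one_div_mul_lt_iff hn0, ← log_ofReal_exp] at hn
  exact ENNReal.log_lt_log_iff.1 hn

lemma exists_frequently_lt_sum_of_pressure_pos {f : ℝ → ℝ} (h : 0 < M.pressure f) :
    ∃ δ > 0, ∃ᶠ n : ℕ in atTop, ENNReal.ofReal (Real.exp (δ * n)) <
      ∑' ω : Fin n → A, ENNReal.ofReal (Real.exp (M.birkhoffSup f ω)) := by
  obtain ⟨δ, hδ, h1⟩ := EReal.lt_iff_exists_real_btwn.1 h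
  refine ⟨δ, by exact_mod_cast hδ, ?_⟩
  refine ((frequently_lt_of_lt_limsup (by isBoundedDefault) h1).and_eventually
    (eventually_gt_atTop 0)).mono fun n hn => ?_
  obtain ⟨hn, hn0⟩ := hn
  rw [lt_one_div_mul_iff hn0, ← log_ofReal_exp] at hn
  exact ENNReal.log_lt_log_iff.1 hn

lemma exists_pressure_nonpos [Finite A] {φ : ℝ → ℝ} (hφ0 : ∀ x ∈ M.repeller, 0 ≤ φ x)
    (e : M.Bounds φ) :
    {s : ℝ | M.pressure (fun x => -s * (M.psi x + φ x)) ≤ 0}.Nonempty := by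
  have := Fintype.ofFinite A
  obtain ⟨i, -⟩ := M.nontriv
  have : Nonempty A := ⟨i⟩
  have hc : (1 : ℝ) ≤ Fintype.card A := by exact_mod_cast Fintype.card_pos
  have hl : 0 ≤ Real.log (Fintype.card A) := Real.log_nonneg hc
  set s : ℝ := (Real.log (Fintype.card A) + 1) / e.θ with hs
  have hθ := e.θ_pos
  have hs0 : 0 ≤ s := by positivity
  have hsθ : s * e.θ = Real.log (Fintype.card A) + 1 := by rw [hs]; field_simp
  refine ⟨s, ?_⟩
  change limsup _ atTop ≤ (0 : EReal)
  refine limsup_le_of_le (h := ?_)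
  obtain ⟨n₀, hn₀⟩ := exists_nat_gt (s * e.c)
  filter_upwards [eventually_ge_atTop n₀] with n hn
  have hn' : s * e.c ≤ n := hn₀.le.trans (by exact_mod_cast hn)
  refine mul_nonpos_of_nonneg_of_nonpos (by exact_mod_cast (by positivity : 0 ≤ 1 / (n : ℝ))) ?_
  rw [← ENNReal.log_one, ENNReal.log_le_log_iff, tsum_fintype]
  have hb : ∀ ω : Fin n → A, M.birkhoffSup (fun x => -s * (M.psi x + φ x)) ω ≤
      -(n * Real.log (Fintype.card A)) := fun ω => by
    refine M.birkhoffSup_le fun x hx => ?_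
    rw [M.birkhoff_neg_mul]
    have h1 := e.expand _ x hx.1
    rw [List.length_ofFn] at h1
    have h2 : 0 ≤ M.birkhoff φ n x :=
      Finset.sum_nonneg fun l _ => hφ0 _ (M.iterate_mem_repeller hx.2 l)
    have h3 := mul_le_mul_of_nonneg_left (add_le_add h1 h2) hs0
    have h4 : s * (e.θ * n - e.c + 0) = n * Real.log (Fintype.card A) + n - s * e.c := by
      linear_combination (n : ℝ) * hsθ
    linarith
  calc ∑ ω : Fin n → A, ENNReal.ofReal
        (Real.exp (M.birkhoffSup (fun x => -s * (M.psi x + φ x)) ω))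
      ≤ ∑ _ω : Fin n → A, ENNReal.ofReal (Real.exp (-(n * Real.log (Fintype.card A)))) :=
        Finset.sum_le_sum fun ω _ => ENNReal.ofReal_le_ofReal (Real.exp_le_exp.2 (hb ω))
    _ = 1 := by
        rw [Finset.sum_const, nsmul_eq_mul, Finset.card_univ, Fintype.card_fun, Fintype.card_fin,
          Real.exp_neg, Real.exp_nat_mul, Real.exp_log (by linarith), ← ENNReal.ofReal_natCast,
          ← ENNReal.ofReal_mul (by positivity)]
        push_cast
        rw [mul_inv_cancel₀ (by positivity), ENNReal.ofReal_one]

/-- The part of the cylinder of `ω` mapped by the `n`-th iterate into the `n`-th target. -/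
def targetPiece (y : ℝ) (φ : ℝ → ℝ) {n : ℕ} (ω : Fin n → A) : Set ℝ :=
  {x | x ∈ M.cyl (List.ofFn ω) ∧ x ∈ M.repeller ∧ |M.T^[n] x - y| < Real.exp (-(M.birkhoff φ n x))}

lemma shrinkingTarget_subset_iUnion_targetPiece (y : ℝ) (φ : ℝ → ℝ) (m : ℕ) :
    M.shrinkingTarget y φ ⊆
      ⋃ i : (k : ℕ) × (Fin (m + k) → A), M.targetPiece y φ i.2 := fun x hx => by
  obtain ⟨n, hx⟩ := mem_iUnion.1 (mem_iInter.1 hx m)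
  obtain ⟨hmn, hx⟩ := mem_iUnion.1 hx
  obtain ⟨k, rfl⟩ := Nat.exists_eq_add_of_le hmn
  obtain ⟨a, ha⟩ := M.exists_coding hx.1
  exact mem_iUnion.2 ⟨⟨k, fun j => a j⟩, ha _, hx⟩

lemma Bounds.abs_sub_le_of_targetPiece {M : ExpandingMarkovMap A} {φ : ℝ → ℝ} (e : M.Bounds φ)
    {y : ℝ} {n : ℕ} {ω : Fin n → A} {w x z : ℝ} (hw : w ∈ M.targetPiece y φ ω)
    (hx : x ∈ M.targetPiece y φ ω) (hz : z ∈ M.targetPiece y φ ω) :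
    |z - x| ≤ 2 * Real.exp (2 * e.R n - (M.birkhoff M.psi n w + M.birkhoff φ n w)) := by
  have h1 := e.abs_sub_le hz.1 hx.1 hw.1
  have h2 : ∀ t ∈ M.targetPiece y φ ω, |M.T^[n] t - y| ≤ Real.exp (e.R n - M.birkhoff φ n w) := by
    intro t ht
    have h3 := (abs_le.1 (e.phi_dist _ t ⟨ht.1, ht.2.1⟩ w ⟨hw.1, hw.2.1⟩)).1
    rw [List.length_ofFn] at h3
    exact ht.2.2.le.trans (Real.exp_le_exp.2 (by linarith))
  rw [List.length_ofFn] at h1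
  have h3 : |M.T^[n] z - M.T^[n] x| ≤ |M.T^[n] z - y| + |M.T^[n] x - y| := by
    rw [abs_sub_comm (M.T^[n] x) y]
    exact _root_.abs_sub_le _ _ _
  have h4 : |M.T^[n] z - M.T^[n] x| ≤ 2 * Real.exp (e.R n - M.birkhoff φ n w) := by
    linarith [h2 x hx, h2 z hz]
  refine h1.trans ((mul_le_mul_of_nonneg_left h4 (Real.exp_pos _).le).trans_eq ?_)
  rw [mul_left_comm, ← Real.exp_add]
  ring_nf

lemma Bounds.ediam_targetPiece_rpow_le {M : ExpandingMarkovMap A} {φ : ℝ → ℝ}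
    (hφ0 : ∀ x ∈ M.repeller, 0 ≤ φ x) (e : M.Bounds φ) {s s₀ : ℝ} (hs : 0 < s) (hs₀ : s₀ < s)
    (y : ℝ) {n : ℕ} (ω : Fin n → A) :
    Metric.ediam (M.targetPiece y φ ω) ^ s ≤
      ENNReal.ofReal (2 ^ s * Real.exp (2 * s * e.R n - (s - s₀) * (e.θ * n - e.c))) *
        ENNReal.ofReal (Real.exp (M.birkhoffSup (fun x => -s₀ * (M.psi x + φ x)) ω)) := by
  rcases (M.targetPiece y φ ω).eq_empty_or_nonempty with h0 | ⟨x, hx⟩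
  · simp [h0, ENNReal.zero_rpow_of_pos hs]
  have h1 := e.le_birkhoffSup s₀ ⟨hx.1, hx.2.1⟩
  have h2 := e.expand _ x hx.1
  rw [List.length_ofFn] at h2
  have h3 : 0 ≤ M.birkhoff φ n x :=
    Finset.sum_nonneg fun l _ => hφ0 _ (M.iterate_mem_repeller hx.2.1 l)
  have h4 : Metric.ediam (M.targetPiece y φ ω) ≤ ENNReal.ofReal
      (2 * Real.exp (2 * e.R n - (M.birkhoff M.psi n x + M.birkhoff φ n x))) :=
    Metric.ediam_le fun a ha b hb => by
      rw [edist_dist, Real.dist_eq]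
      exact ENNReal.ofReal_le_ofReal (e.abs_sub_le_of_targetPiece hx hb ha)
  refine (ENNReal.rpow_le_rpow h4 hs.le).trans ?_
  rw [ENNReal.ofReal_rpow_of_nonneg (by positivity) hs.le, ← ENNReal.ofReal_mul (by positivity)]
  refine ENNReal.ofReal_le_ofReal ?_
  rw [Real.mul_rpow (by norm_num) (Real.exp_pos _).le, ← Real.exp_mul, mul_assoc, ← Real.exp_add]
  refine mul_le_mul_of_nonneg_left (Real.exp_le_exp.2 ?_) (by positivity)
  have h5 := mul_le_mul_of_nonneg_left (add_le_add h2 h3) (sub_pos.2 hs₀).le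
  linarith

lemma Bounds.exists_sum_ediam_targetPiece_le {M : ExpandingMarkovMap A} {φ : ℝ → ℝ}
    (hφ0 : ∀ x ∈ M.repeller, 0 ≤ φ x) (e : M.Bounds φ) {s s₀ : ℝ} (hs : 0 < s) (hs₀ : s₀ < s)
    (hP : M.pressure (fun x => -s₀ * (M.psi x + φ x)) ≤ 0) (y : ℝ) :
    ∃ K q : ℝ, 0 ≤ K ∧ 0 ≤ q ∧ q < 1 ∧ ∀ᶠ n : ℕ in atTop,
      ∑' ω : Fin n → A, Metric.ediam (M.targetPiece y φ ω) ^ s ≤ ENNReal.ofReal (K * q ^ n) := by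
  set η := (s - s₀) * e.θ with hη
  have hη0 : 0 < η := mul_pos (sub_pos.2 hs₀) e.θ_pos
  obtain ⟨C, hC, hR⟩ := e.R_small (η / (8 * s)) (by positivity)
  refine ⟨2 ^ s * Real.exp (2 * s * C + (s - s₀) * e.c), Real.exp (-(η / 2)), by positivity,
    (Real.exp_pos _).le, by rw [Real.exp_lt_one_iff]; linarith, ?_⟩
  filter_upwards [M.eventually_sum_lt_of_pressure_le hP (γ := η / 4) (by positivity)] with n hn
  refine (ENNReal.tsum_le_tsum fun ω => e.ediam_targetPiece_rpow_le hφ0 hs hs₀ y ω).trans ?_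
  rw [ENNReal.tsum_mul_left]
  refine (mul_le_mul_right hn.le _).trans ?_
  rw [← ENNReal.ofReal_mul (by positivity)]
  refine ENNReal.ofReal_le_ofReal ?_
  rw [mul_assoc (2 ^ s), mul_assoc (2 ^ s), ← Real.exp_add, ← Real.exp_nat_mul, ← Real.exp_add]
  refine mul_le_mul_of_nonneg_left (Real.exp_le_exp.2 ?_) (by positivity)
  have h1 := mul_le_mul_of_nonneg_left (hR n) (by positivity : 0 ≤ 2 * s)
  have h2 : 2 * s * (η / (8 * s) * n + C) = η / 4 * n + 2 * s * C := by field_simp; ring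
  have h3 : (s - s₀) * (e.θ * n - e.c) = η * n - (s - s₀) * e.c := by rw [hη]; ring
  linarith

lemma Bounds.dimH_shrinkingTarget_le [Finite A] {M : ExpandingMarkovMap A} {φ : ℝ → ℝ}
    (hφ0 : ∀ x ∈ M.repeller, 0 ≤ φ x) (e : M.Bounds φ) {s : NNReal} {s₀ : ℝ} (hs : 0 < s)
    (hs₀ : s₀ < s) (hP : M.pressure (fun x => -s₀ * (M.psi x + φ x)) ≤ 0) (y : ℝ) :
    dimH (M.shrinkingTarget y φ) ≤ s := by
  refine dimH_le_of_hausdorffMeasure_ne_top ?_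
  obtain ⟨K, q, hK, hq0, hq1, hsum⟩ :=
    e.exists_sum_ediam_targetPiece_le hφ0 (by exact_mod_cast hs : (0 : ℝ) < s) hs₀ hP y
  have hle : MeasureTheory.Measure.hausdorffMeasure (s : ℝ) (M.shrinkingTarget y φ) ≤
      ENNReal.ofReal (K * (1 - q)⁻¹) := by
    refine (MeasureTheory.Measure.hausdorffMeasure_le_liminf_tsum (l := atTop)
      (ι := fun m : ℕ => (k : ℕ) × (Fin (m + k) → A)) (s : ℝ) _
      (fun m => ⨆ i : (k : ℕ) × (Fin (m + k) → A), Metric.ediam (M.targetPiece y φ i.2)) ?_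
      (fun m i => M.targetPiece y φ i.2) (Eventually.of_forall fun m i => le_iSup
        (fun i : (k : ℕ) × (Fin (m + k) → A) => Metric.ediam (M.targetPiece y φ i.2)) i)
      (Eventually.of_forall fun m => M.shrinkingTarget_subset_iUnion_targetPiece y φ m)).trans ?_
    · refine ENNReal.tendsto_nhds_zero.2 fun ε hε => ?_
      obtain ⟨r, -, hr0, hrε⟩ := ENNReal.lt_iff_exists_real_btwn.1 hε
      obtain ⟨n₀, hn₀⟩ := e.exists_small (ENNReal.ofReal_pos.1 hr0)
      filter_upwards [eventually_ge_atTop n₀] with m hm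
      refine iSup_le fun i => (Metric.ediam_le fun a ha b hb => ?_).trans hrε.le
      rw [edist_dist, Real.dist_eq]
      refine ENNReal.ofReal_le_ofReal (hn₀ _ ?_ a ha.1 b hb.1).le
      rw [List.length_ofFn]
      omega
    · refine le_trans liminf_le_limsup (limsup_le_of_le (h := ?_))
      obtain ⟨n₁, hn₁⟩ := eventually_atTop.1 hsum
      filter_upwards [eventually_ge_atTop n₁] with m hm
      rw [ENNReal.tsum_sigma']
      calc ∑' k, ∑' ω : Fin (m + k) → A, Metric.ediam (M.targetPiece y φ ω) ^ (s : ℝ)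
          ≤ ∑' k : ℕ, ENNReal.ofReal (K * q ^ k) := ENNReal.tsum_le_tsum fun k =>
            (hn₁ (m + k) (by omega)).trans (ENNReal.ofReal_le_ofReal
              (mul_le_mul_of_nonneg_left (pow_le_pow_of_le_one hq0 hq1.le (by omega)) hK))
        _ = ENNReal.ofReal (K * (1 - q)⁻¹) := by
            rw [← ENNReal.ofReal_tsum_of_nonneg (fun k => by positivity)
              ((summable_geometric_of_lt_one hq0 hq1).mul_left K), tsum_mul_left,
              tsum_geometric_of_lt_one hq0 hq1]
  exact ne_top_of_le_ne_top ENNReal.ofReal_ne_top hle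

lemma Bounds.dimH_shrinkingTarget_le_sdim [Finite A] {M : ExpandingMarkovMap A} {φ : ℝ → ℝ}
    (hφ0 : ∀ x ∈ M.repeller, 0 ≤ φ x) (e : M.Bounds φ) (y : ℝ) :
    dimH (M.shrinkingTarget y φ) ≤ ENNReal.ofReal (M.sdim φ) := by
  by_contra! h
  obtain ⟨s, hs, hs'⟩ := ENNReal.lt_iff_exists_nnreal_btwn.1 h
  have h0 : 0 < s := by exact_mod_cast (zero_le).trans_lt hs
  have h1 : M.sdim φ < s := by
    rw [← ENNReal.ofReal_coe_nnreal] at hs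
    exact (ENNReal.ofReal_lt_ofReal_iff (by exact_mod_cast h0)).1 hs
  obtain ⟨s₀, hP, hs₀⟩ := exists_lt_of_csInf_lt (M.exists_pressure_nonpos hφ0 e) h1
  exact absurd (e.dimH_shrinkingTarget_le hφ0 h0 hs₀ hP y) (not_le.2 hs')

end ExpandingMarkovMap

section MassDistribution

open MeasureTheory

lemma ofReal_le_dimH_of_measure_closedBall_le {s C : ℝ} (hs : 0 < s) (hC : 0 < C) (μ : Measure ℝ)
    (h : ∀ x r : ℝ, 0 < r → r < 1 → μ (Metric.closedBall x r) ≤ ENNReal.ofReal (C * r ^ s))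
    {D : Set ℝ} (hD : μ D ≠ 0) : ENNReal.ofReal s ≤ dimH D := by
  have hC0 : ENNReal.ofReal C ≠ 0 := by simpa using hC
  have hle : (ENNReal.ofReal C)⁻¹ • μ ≤ μH[s] := by
    refine Measure.le_hausdorffMeasure s _ (ENNReal.ofReal (1 / 2)) (by simp) fun U hU => ?_
    rw [Measure.smul_apply, smul_eq_mul]
    rcases U.eq_empty_or_nonempty with rfl | ⟨x, hx⟩
    · simp
    set d := (Metric.ediam U).toReal with hd
    have hfin : Metric.ediam U ≠ ⊤ := ne_top_of_le_ne_top ENNReal.ofReal_ne_top hU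
    have hd0 : 0 ≤ d := ENNReal.toReal_nonneg
    have hd1 : d < 1 := by
      have := ENNReal.toReal_mono ENNReal.ofReal_ne_top hU
      rw [ENNReal.toReal_ofReal (by norm_num)] at this
      linarith
    have hball : ∀ r, d < r → U ⊆ Metric.closedBall x r := fun r hr z hz => by
      have h1 := Metric.edist_le_ediam_of_mem hz hx
      rw [edist_dist] at h1
      have h2 := ENNReal.toReal_mono hfin h1
      rw [ENNReal.toReal_ofReal dist_nonneg] at h2
      exact h2.trans hr.le
    have hμ : μ U ≤ ENNReal.ofReal (C * d ^ s) := by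
      have hcont : Continuous fun r : ℝ => ENNReal.ofReal (C * r ^ s) :=
        ENNReal.continuous_ofReal.comp
          (continuous_const.mul (Real.continuous_rpow_const hs.le))
      refine ge_of_tendsto (hcont.continuousWithinAt (s := Ioi d) (x := d)) ?_
      filter_upwards [Ioo_mem_nhdsGT hd1] with r hr
      exact (measure_mono (hball r hr.1)).trans (h x r (hd0.trans_lt hr.1) hr.2)
    rw [ENNReal.ofReal_mul hC.le, ← ENNReal.ofReal_rpow_of_nonneg hd0 hs.le, hd,
      ENNReal.ofReal_toReal hfin] at hμ
    calc (ENNReal.ofReal C)⁻¹ * μ U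
        ≤ (ENNReal.ofReal C)⁻¹ * (ENNReal.ofReal C * Metric.ediam U ^ s) := by gcongr
      _ = Metric.ediam U ^ s := by
          rw [← mul_assoc, ENNReal.inv_mul_cancel hC0 ENNReal.ofReal_ne_top, one_mul]
  refine le_dimH_of_hausdorffMeasure_ne_zero (d := s.toNNReal) ?_
  rw [Real.coe_toNNReal s hs.le]
  intro h0
  have h1 := hle D
  rw [h0, Measure.smul_apply, smul_eq_mul, nonpos_iff_eq_zero, mul_eq_zero] at h1
  rcases h1 with h1 | h1
  · simp at h1
  · exact hD h1

/-- A mass distribution principle for a nested family of sets indexed by finite prefixes of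
sequences in a finite alphabet, with the Bernoulli measure of weights `q`. -/
lemma ofReal_le_dimH_of_nested {β : Type*} [Fintype β] [Nonempty β] {q : β → ℝ}
    (hq0 : ∀ b, 0 ≤ q b) (hq1 : ∑ b, q b = 1) {s K : ℝ} (hs : 0 < s) (hK : 0 < K)
    (S S' : (ℕ → β) → ℕ → Set ℝ) (π : (ℕ → β) → ℝ)
    (hS : ∀ N ω ω', (∀ i < N, ω i = ω' i) → S ω N = S ω' N)
    (hS' : ∀ N ω ω', (∀ i < N + 1, ω i = ω' i) → S' ω N = S' ω' N)
    (hSS' : ∀ ω N, S ω (N + 1) ⊆ S' ω N) (hS'S : ∀ ω N, S' ω N ⊆ S ω N)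
    (hdisj : ∀ N ω ω', (∀ i < N, ω i = ω' i) → ω N ≠ ω' N → Disjoint (S' ω N) (S' ω' N))
    (hmeas : ∀ ω N, MeasurableSet (S' ω N)) (hπ : ∀ ω N, π ω ∈ S ω N)
    (hsmall : ∀ r > 0, ∃ N₀, ∀ N, N₀ ≤ N → ∀ ω, ∀ z ∈ S ω N, ∀ z' ∈ S ω N, |z - z'| ≤ r)
    (h0 : ∀ ω, S ω 0 = Icc 0 1)
    (hweight : ∀ ω N x r, 0 < r → r < 1 → (∃ z ∈ S ω N, ∃ z' ∈ S ω N, r < |z - z'|) →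
      (∀ z ∈ S ω (N + 1), ∀ z' ∈ S ω (N + 1), |z - z'| ≤ r) → |π ω - x| ≤ r →
      ENNReal.ofReal (∏ i ∈ Finset.range (N + 1), q (ω i)) ≤
        ENNReal.ofReal (K * r ^ (s - 1)) * volume (S' ω N ∩ Metric.closedBall x (2 * r)))
    {D : Set ℝ} (hD : range π ⊆ D) : ENNReal.ofReal s ≤ dimH D := by
  classical
  let _ : MeasurableSpace β := ⊤
  have : MeasurableSingletonClass β := ⟨fun _ => trivial⟩
  have hq1' : ∑ b, ENNReal.ofReal (q b) = 1 := by
    rw [← ENNReal.ofReal_sum_of_nonneg fun b _ => hq0 b, hq1, ENNReal.ofReal_one]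
  let p : PMF β := PMF.ofFintype (fun b => ENNReal.ofReal (q b)) hq1'
  let P : Measure (ℕ → β) := Measure.infinitePi fun _ => p.toMeasure
  let Z : (ℕ → β) → ℕ → Set (ℕ → β) := fun ω N => {ω' | ∀ i < N, ω' i = ω i}
  have hZ : ∀ ω N, P (Z ω N) = ENNReal.ofReal (∏ i ∈ Finset.range N, q (ω i)) := fun ω N => by
    have h1 : Z ω N = (↑(Finset.range N) : Set ℕ).pi fun i => {ω i} := by
      ext ω'
      simp [Z]
    rw [h1, Measure.infinitePi_pi _ fun i _ => measurableSet_singleton _,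
      ENNReal.ofReal_prod_of_nonneg fun i _ => hq0 _]
    refine Finset.prod_congr rfl fun i _ => ?_
    rw [PMF.toMeasure_apply_singleton _ _ (measurableSet_singleton _)]
    rfl
  have hπm : Measurable π := by
    obtain ⟨b₀⟩ := ‹Nonempty β›
    let t : ℕ → (ℕ → β) → ℕ → β := fun N ω i => if i < N then ω i else b₀
    refine measurable_of_tendsto_metrizable (f := fun N ω => π (t N ω)) (fun N => ?_) ?_
    · have h1 : (fun ω => π (t N ω)) =
          (fun v : Fin N → β => π fun i => if h : i < N then v ⟨i, h⟩ else b₀) ∘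
            fun ω (k : Fin N) => ω k := by
        ext ω
        simp only [Function.comp, t]
        congr 1
      rw [h1]
      exact (measurable_of_countable _).comp (by fun_prop)
    · rw [tendsto_pi_nhds]
      intro ω
      rw [Metric.tendsto_atTop]
      intro r hr
      obtain ⟨N₀, hN₀⟩ := hsmall (r / 2) (by positivity)
      refine ⟨N₀, fun N hN => ?_⟩
      have h2 : S (t N ω) N = S ω N := hS N _ _ fun i hi => by simp [t, hi]
      have h3 := hN₀ N hN ω _ (h2 ▸ hπ (t N ω) N) _ (hπ ω N)
      rw [Real.dist_eq]
      linarith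
  have hkey : ∀ x r : ℝ, 0 < r → r < 1 → P (π ⁻¹' Metric.closedBall x r) ≤
      ENNReal.ofReal (4 * K * r ^ s) := by
    intro x r hr hr1
    obtain ⟨N₀, hN₀⟩ := hsmall r hr
    have hind : ∀ k N ω, N + k = N₀ → (∃ z ∈ S ω N, ∃ z' ∈ S ω N, r < |z - z'|) →
        P (Z ω N ∩ π ⁻¹' Metric.closedBall x r) ≤
          ENNReal.ofReal (K * r ^ (s - 1)) * volume (S ω N ∩ Metric.closedBall x (2 * r)) := by
      intro k
      induction k with
      | zero =>
        rintro N ω hN ⟨z, hz, z', hz', h⟩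
        exact absurd (hN₀ N (by omega) ω z hz z' hz') (not_le.2 h)
      | succ k ih =>
        intro N ω hN hbig
        let u : β → ℕ → β := fun b => Function.update ω N b
        have hu : ∀ b, ∀ i < N, u b i = ω i := fun b i hi =>
          Function.update_of_ne (by omega) _ _
        have huN : ∀ b, u b N = b := fun b => Function.update_self _ _ _
        have hcov : Z ω N ∩ π ⁻¹' Metric.closedBall x r ⊆
            ⋃ b, (Z (u b) (N + 1) ∩ π ⁻¹' Metric.closedBall x r) := by
          rintro ω' ⟨h1, h2⟩
          refine mem_iUnion.2 ⟨ω' N, fun i hi => ?_, h2⟩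
          rcases Nat.lt_succ_iff_lt_or_eq.1 hi with h | rfl
          · rw [hu _ _ h, h1 i h]
          · rw [huN]
        have hpiece : ∀ b, P (Z (u b) (N + 1) ∩ π ⁻¹' Metric.closedBall x r) ≤
            ENNReal.ofReal (K * r ^ (s - 1)) *
              volume (S' (u b) N ∩ Metric.closedBall x (2 * r)) := by
          intro b
          by_cases hb : ∃ z ∈ S (u b) (N + 1), ∃ z' ∈ S (u b) (N + 1), r < |z - z'|
          · refine (ih (N + 1) (u b) (by omega) hb).trans ?_
            gcongr
            exact hSS' _ _
          rcases (Z (u b) (N + 1) ∩ π ⁻¹' Metric.closedBall x r).eq_empty_or_nonempty with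
            h1 | ⟨ω', h1, h2⟩
          · rw [h1]
            simp
          push Not at hb
          have hS1 := hS (N + 1) ω' (u b) h1
          have hS0 : S ω' N = S ω N := hS N _ _ fun i hi => by
            rw [h1 i (by omega), hu b i hi]
          refine (measure_mono inter_subset_left).trans ?_
          rw [hZ, ← hS' N ω' (u b) h1]
          have hprod : ∏ i ∈ Finset.range (N + 1), q (u b i) =
              ∏ i ∈ Finset.range (N + 1), q (ω' i) :=
            Finset.prod_congr rfl fun i hi => by rw [h1 i (Finset.mem_range.1 hi)]
          rw [hprod]
          exact hweight ω' N x r hr hr1 (by rwa [hS0]) (by rwa [hS1]) h2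
        have hdis : Pairwise (Function.onFun Disjoint
            fun b => S' (u b) N ∩ Metric.closedBall x (2 * r)) := fun b b' hbb' =>
          (hdisj N (u b) (u b') (fun i hi => by rw [hu b i hi, hu b' i hi])
            (by rwa [huN, huN])).mono inter_subset_left inter_subset_left
        calc P (Z ω N ∩ π ⁻¹' Metric.closedBall x r)
            ≤ ∑' b, P (Z (u b) (N + 1) ∩ π ⁻¹' Metric.closedBall x r) :=
              (measure_mono hcov).trans (measure_iUnion_le _)
          _ ≤ ∑' b, ENNReal.ofReal (K * r ^ (s - 1)) *
              volume (S' (u b) N ∩ Metric.closedBall x (2 * r)) := ENNReal.tsum_le_tsum hpiece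
          _ = ENNReal.ofReal (K * r ^ (s - 1)) *
              volume (⋃ b, (S' (u b) N ∩ Metric.closedBall x (2 * r))) := by
              rw [ENNReal.tsum_mul_left, measure_iUnion hdis fun b =>
                (hmeas _ _).inter measurableSet_closedBall]
          _ ≤ _ := by
              gcongr
              refine iUnion_subset fun b => inter_subset_inter_left _ ?_
              rw [← hS N (u b) ω (hu b)]
              exact hS'S _ _
    obtain ⟨b₀⟩ := ‹Nonempty β›
    let ω₀ : ℕ → β := fun _ => b₀
    have h1 := hind N₀ 0 ω₀ (zero_add _) ⟨0, by simp [h0], 1, by simp [h0], by simpa using hr1⟩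
    have h2 : Z ω₀ 0 = univ := by simp [Z]
    rw [h2, univ_inter] at h1
    refine h1.trans ((mul_le_mul_right (measure_mono inter_subset_right) _).trans ?_)
    rw [Real.volume_closedBall, ← ENNReal.ofReal_mul (by positivity)]
    apply ENNReal.ofReal_le_ofReal
    have h3 : r ^ s = r ^ (s - 1) * r := by
      rw [← Real.rpow_add_one hr.ne']
      simp
    rw [h3]
    apply le_of_eq
    ring
  refine ofReal_le_dimH_of_measure_closedBall_le (C := 4 * K) hs (by positivity) (P.map π)
    (fun x r hr hr1 => ?_) (D := D) fun h => ?_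
  · rw [Measure.map_apply hπm measurableSet_closedBall]
    exact hkey x r hr hr1
  · have h1 := Measure.le_map_apply hπm.aemeasurable (μ := P) D
    rw [h, preimage_eq_univ_iff.2 hD, measure_univ] at h1
    simp at h1

end MassDistribution

namespace ExpandingMarkovMap

variable {A : Type} {M : ExpandingMarkovMap A} {φ : ℝ → ℝ} (e : M.Bounds φ)

namespace Bounds

lemma abs_psi_le_of_mem_repeller {x : ℝ} (hx : x ∈ M.repeller) (n : ℕ) :
    |M.birkhoff M.psi n x| ≤ n * e.B :=
  M.birkhoff_abs_le fun l _ => by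
    obtain ⟨i, hi⟩ := mem_iUnion.1 (hx l)
    exact e.psi_le i _ hi

/-- Every word `τ` extends to a word `τ ++ w` all of whose points hit the target at time
`τ.length`, the contraction along `w` being essentially the size of the target. -/
lemma exists_hitting_word (e : M.Bounds φ) (hφ0 : ∀ x ∈ M.repeller, 0 ≤ φ x) {y : ℝ} (hy : y ∈ closure M.repeller)
    {ε : ℝ} (hε : 0 < ε) : ∃ c C : ℝ, 0 ≤ c ∧ 0 ≤ C ∧ ∀ τ : List A, ∃ w : List A,
      closure (M.cyl (τ ++ w)) ⊆ M.cyl τ ∧ (w.length : ℝ) ≤ C * (τ.length + 1) ∧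
      ∀ x ∈ M.cyl (τ ++ w) ∩ M.repeller,
        |M.T^[τ.length] x - y| < Real.exp (-(M.birkhoff φ τ.length x)) ∧
        M.birkhoff M.psi w.length (M.T^[τ.length] x) ≤
          M.birkhoff φ τ.length x + ε * τ.length + c := by
  obtain ⟨κ, -, a, b, ha, hab, hb, hκ⟩ := M.exists_inner_word
  have hθ := e.θ_pos
  have hc := e.c_nonneg
  have hB := e.B_nonneg
  obtain ⟨C₁, hC₁0, hC₁⟩ := e.R_small 1 one_pos
  obtain ⟨C₂, hC₂0, hC₂⟩ := e.R_small (e.θ / 2) (by positivity)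
  set C₀ := 2 / e.θ * (e.B + 1 + C₁ + e.c + C₂ + 1) with hC₀
  have hC₀0 : 0 ≤ C₀ := by positivity
  obtain ⟨C₃, hC₃0, hC₃⟩ := e.R_small (ε / (2 * (C₀ + 1))) (by positivity)
  obtain ⟨C₄, hC₄0, hC₄⟩ := e.R_small (ε / 4) (by positivity)
  refine ⟨ε / 2 + C₃ + 1 + 2 * C₄ + (1 + κ.length) * e.B, C₀ + 1 + κ.length, by positivity,
    by positivity, fun τ => ?_⟩
  set n := τ.length with hn
  obtain ⟨xτ, hxτ⟩ := M.cyl_inter_repeller_nonempty τ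
  set L := M.birkhoff φ n xτ + e.R n with hL
  have hL0 : 0 ≤ L := add_nonneg
    (Finset.sum_nonneg fun l _ => hφ0 _ (M.iterate_mem_repeller hxτ.2 l)) (e.R_nonneg n)
  have hLn : L ≤ n * e.B + (n + C₁) := by
    have h1 := (abs_le.1 (e.abs_phi_le hxτ.2 n)).2
    have h2 := hC₁ n
    linarith
  have hlog2 : Real.log 2 ≤ 1 := by
    have := Real.log_two_lt_d9
    linarith
  set r := Real.exp (-L) with hr
  have hr0 : 0 < r := Real.exp_pos _
  have hr1 : r ≤ 1 := Real.exp_le_one_iff.2 (by linarith)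
  obtain ⟨z, hz, hzy⟩ := Metric.mem_closure_iff.1 hy (r / 2) (by positivity)
  obtain ⟨α, hα⟩ := M.exists_coding hz
  set ζ : ℕ → List A := fun k => List.ofFn fun i : Fin k => α i with hζ
  have hζl : ∀ k, (ζ k).length = k := fun k => List.length_ofFn
  have hex : ∃ k, ∀ p ∈ M.cyl (ζ k), ∀ p' ∈ M.cyl (ζ k), |p - p'| < r / 2 := by
    obtain ⟨k, hk⟩ := e.exists_small (r := r / 2) (by positivity)
    exact ⟨k, hk (ζ k) (hζl k).ge⟩
  classical
  obtain ⟨m, hm⟩ : ∃ m, Nat.find hex = m + 1 := Nat.exists_eq_succ_of_ne_zero fun h0 => by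
    have h1 := Nat.find_spec hex
    rw [h0] at h1
    have h2 := h1 0 (by simp [hζ, cyl]) 1 (by simp [hζ, cyl])
    norm_num at h2
    linarith
  have hm1 : ∀ p ∈ M.cyl (ζ (m + 1)), ∀ p' ∈ M.cyl (ζ (m + 1)), |p - p'| < r / 2 := by
    rw [← hm]
    exact Nat.find_spec hex
  have hm2 := Nat.find_min hex (m := m) (by omega)
  push Not at hm2
  obtain ⟨p, hp, p', hp', hpp⟩ := hm2
  have hpsi : ∀ x ∈ M.cyl (ζ m), M.birkhoff M.psi m x ≤ e.R m + 1 + L := by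
    intro x hx
    have h1 := hpp.trans (e.abs_sub_le_exp hp hp' hx)
    rw [hζl] at h1
    have h2 : r / 2 = Real.exp (-L - Real.log 2) := by
      rw [Real.exp_sub, Real.exp_log two_pos]
    rw [h2, Real.exp_le_exp] at h1
    linarith
  have hsub : M.cyl (ζ (m + 1)) ⊆ M.cyl (ζ m) := fun x hx => by
    have h1 := (M.mem_cyl_ofFn _ x).1 hx
    exact (M.mem_cyl_ofFn _ x).2 ⟨h1.1, fun ν => h1.2 (Fin.castSucc ν)⟩
  have hmC : (m : ℝ) ≤ C₀ * (n + 1) := by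
    have h1 := hpsi p hp
    have h2 := e.expand (ζ m) p hp
    rw [hζl] at h2
    have h3 := hC₂ m
    have h4 : e.θ / 2 * m ≤ (e.B + 1 + C₁ + e.c + C₂ + 1) * (n + 1) := by
      have h5 : (e.B + 1 + C₁ + e.c + C₂ + 1) * (n + 1) = (n * e.B + (n + C₁)) + e.c + C₂ + 1
        + (e.B + 1 + (C₁ + e.c + C₂ + 1) * n) := by ring
      have h6 : 0 ≤ e.B + 1 + (C₁ + e.c + C₂ + 1) * n := by positivity
      linarith
    have h5 : (m : ℝ) = 2 / e.θ * (e.θ / 2 * m) := by field_simp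
    rw [h5, hC₀, mul_assoc]
    gcongr
  refine ⟨ζ (m + 1) ++ κ, ?_, ?_, fun x hx => ?_⟩
  · rw [← List.append_assoc]
    exact (M.closure_cyl_append_subset ha hab hb hκ _).trans (M.cyl_append_subset _ _)
  · rw [List.length_append, hζl]
    push_cast
    nlinarith [(Nat.cast_nonneg n : (0:ℝ) ≤ n), (Nat.cast_nonneg κ.length : (0:ℝ) ≤ κ.length)]
  have hxτ' := (M.mem_cyl_append _ _ _).1 hx.1
  have hxζ := M.cyl_append_subset _ _ hxτ'.2
  have hphi := abs_le.1 (e.phi_dist τ x ⟨hxτ'.1, hx.2⟩ xτ hxτ)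
  rw [← hn] at hphi hxζ
  refine ⟨?_, ?_⟩
  · have h1 := hm1 _ hxζ z (hα (m + 1))
    have h2 : r ≤ Real.exp (-(M.birkhoff φ n x)) := Real.exp_le_exp.2 (by linarith)
    have h3 := _root_.abs_sub_le (M.T^[n] x) z y
    rw [dist_comm, Real.dist_eq] at hzy
    linarith
  · rw [List.length_append, hζl, add_assoc, M.birkhoff_add]
    have h1 := hpsi _ (hsub hxζ)
    have h2 := (abs_le.1 (e.abs_psi_le_of_mem_repeller (M.iterate_mem_repeller
      (M.iterate_mem_repeller hx.2 n) m) (1 + κ.length))).2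
    push_cast at h2
    have h3 := hC₃ m
    have h4 := hC₄ n
    have h5 : ε / (2 * (C₀ + 1)) * m ≤ ε / 2 * (n + 1) := by
      calc ε / (2 * (C₀ + 1)) * m ≤ ε / (2 * (C₀ + 1)) * ((C₀ + 1) * (n + 1)) := by
            gcongr
            nlinarith [(Nat.cast_nonneg n : (0:ℝ) ≤ n)]
        _ = ε / 2 * (n + 1) := by field_simp
    linarith

end Bounds
end ExpandingMarkovMap

/-- There is an infinite sparse set `J` of times such that corrections made at the times in `J`,
of size comparable to the accumulated length `ℓ`, do not spoil the linear decay of `E`. -/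
lemma exists_sparse_set {p : ℕ} {a C C' : ℝ} (ha : 0 < a) (hC : 0 ≤ C) (hC' : 0 ≤ C') :
    ∃ J : Set ℕ, (∀ N, ∃ m, N ≤ m ∧ m + 1 ∈ J) ∧ ∀ (ℓ : ℕ → ℕ) (E G : ℕ → ℝ) (κ c : ℝ),
      0 ≤ κ → 0 ≤ c → κ * (p + 1) ≤ a / 4 → ℓ 0 = 0 → E 0 = 0 → G 0 = 0 →
      (∀ N, N + 1 ∉ J →
        ℓ (N + 1) = ℓ N + p ∧ E (N + 1) ≤ E N - a ∧ G (N + 1) ≤ G N - a) →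
      (∀ N, N + 1 ∈ J → (ℓ (N + 1) : ℝ) ≤ ℓ N + p + C * (ℓ N + p + 1) ∧
        E (N + 1) ≤ G N - a + (κ * (ℓ N + p) + c) ∧
        G (N + 1) ≤ G N - a + C' * (ℓ N + p + 1)) →
      ∀ N, E N ≤ -(a / 2) * N + c ∧ (ℓ N : ℝ) ≤ ((1 + p) * (1 + C) + C) * N := by
  obtain ⟨D, hD⟩ := exists_nat_ge (max (1 + C) (4 * C' / a))
  have hD1 : 1 + C ≤ D := (le_max_left _ _).trans hD
  have hD2 : C' ≤ a / 4 * D := by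
    have := (le_max_right _ _).trans hD
    rw [div_le_iff₀ ha] at this
    linarith
  obtain ⟨h, hzero, hsucc⟩ : ∃ h : ℕ → ℕ, h 0 = 0 ∧ ∀ N, h (N + 1) = h N + D * (h N + p + 1) :=
    ⟨fun N => Nat.rec 0 (fun _ k => k + D * (k + p + 1)) N, rfl, fun _ => rfl⟩
  obtain ⟨g, hg⟩ : ∃ g : ℕ → ℕ, ∀ j, g (j + 1) = g j + 1 + h (g j) :=
    ⟨fun j => Nat.rec 1 (fun _ k => k + 1 + h k) j, fun _ => rfl⟩
  have hmono : StrictMono g := strictMono_nat_of_lt_succ fun j => by rw [hg]; omega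
  refine ⟨range g, fun N => ⟨g (N + 1) - 1, ?_, N + 1, ?_⟩, ?_⟩
  · have := hmono.le_apply (x := N + 1)
    omega
  · have := hmono.le_apply (x := N + 1)
    omega
  intro ℓ E G κ c hκ hc hκp hℓ0 hE0 hG0 hfree hforced
  have hp : (0 : ℝ) ≤ p := Nat.cast_nonneg p
  have hh : ∀ N, (h (N + 1) : ℝ) = h N + D * (h N + p + 1) := fun N => by
    rw [hsucc]
    push_cast
    ring
  have hcrude : ∀ N, (ℓ N : ℝ) ≤ h N ∧ G N + a * N ≤ a / 4 * h N := by
    intro N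
    induction N with
    | zero => simp [hℓ0, hG0, hzero]
    | succ N ih =>
      have hℓ : (0 : ℝ) ≤ ℓ N := Nat.cast_nonneg _
      have h1 : (1 + C) * (ℓ N + p + 1) ≤ D * (h N + p + 1) := by
        gcongr
        exact_mod_cast ih.1
      have h2 : C' * (ℓ N + p + 1) ≤ a / 4 * D * (h N + p + 1) := by
        gcongr
        exact_mod_cast ih.1
      have h3 : 0 ≤ C * (ℓ N + p + 1) := by positivity
      have h4 : 0 ≤ C' * (ℓ N + p + 1) := by positivity
      rw [hh]
      push_cast
      by_cases hN : N + 1 ∈ range g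
      · have := hforced N hN
        constructor <;> linarith
      · have h5 := hfree N hN
        rw [h5.1]
        push_cast
        constructor <;> linarith
  suffices H : ∀ N, ∃ m ≤ N, (m = 0 ∨ m ∈ range g) ∧ (ℓ N : ℝ) ≤ h m + p * (N - m) ∧
      G N + a * N ≤ a / 4 * h m ∧ E N ≤ -(a / 2) * N + c ∧
      (ℓ N : ℝ) ≤ ((1 + p) * (1 + C) + C) * N from fun N => by
    obtain ⟨m, -, -, -, -, h1, h2⟩ := H N
    exact ⟨h1, h2⟩
  intro N
  induction N with
  | zero => exact ⟨0, le_rfl, Or.inl rfl, by simp [hℓ0], by simp [hG0, hzero], by simp [hE0, hc],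
      by simp [hℓ0]⟩
  | succ N ih =>
    obtain ⟨m, hmN, hm, h1, h2, h3, h4⟩ := ih
    have hpC : 0 ≤ p * C := by positivity
    by_cases hN : N + 1 ∈ range g
    · have hmN' : h m ≤ N + 1 := by
        rcases hm with rfl | ⟨j, rfl⟩
        · omega
        · obtain ⟨k, hk⟩ := hN
          have hjk : j < k := hmono.lt_iff_lt.1 (by omega)
          have := hmono.monotone (Nat.succ_le_of_lt hjk)
          rw [Nat.succ_eq_add_one, hg] at this
          omega
      have hmN'' : (h m : ℝ) ≤ N + 1 := by exact_mod_cast hmN'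
      obtain ⟨f1, f2, f3⟩ := hforced N hN
      have h5 : (ℓ N : ℝ) + p ≤ (1 + p) * (N + 1) := by
        have : (p : ℝ) * m ≥ 0 := by positivity
        linarith
      have h6 : C * (ℓ N + p + 1) ≤ C * ((1 + p) * (N + 1) + 1) := by gcongr
      have h7 : κ * (ℓ N + p) ≤ a / 4 * (N + 1) := by
        calc κ * (ℓ N + p) ≤ κ * ((1 + p) * (N + 1)) := by gcongr
          _ = κ * (p + 1) * (N + 1) := by ring
          _ ≤ a / 4 * (N + 1) := by gcongr
      have h8 : a / 4 * h m ≤ a / 4 * (N + 1) := by gcongr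
      have hCN : 0 ≤ C * N := by positivity
      refine ⟨N + 1, le_rfl, Or.inr hN, ?_, (hcrude (N + 1)).2, ?_, ?_⟩
      · have := (hcrude (N + 1)).1
        push_cast
        linarith
      · push_cast
        linarith
      · push_cast
        linarith
    · obtain ⟨f1, f2, f3⟩ := hfree N hN
      refine ⟨m, hmN.trans (Nat.le_succ N), hm, ?_, ?_, ?_, ?_⟩
      · rw [f1]
        push_cast
        linarith
      · push_cast
        linarith
      · push_cast
        linarith
      · rw [f1]
        push_cast
        linarith

lemma ofReal_le_volume_inter_closedBall {J : Set ℝ} (hJ : J.OrdConnected) {x₀ z z' x r t : ℝ}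
    (hx₀ : x₀ ∈ J) (hz : z ∈ J) (hz' : z' ∈ J) (ht : 2 * t ≤ |z - z'|) (htr : t ≤ r)
    (hx : |x₀ - x| ≤ r) :
    ENNReal.ofReal t ≤ MeasureTheory.volume (J ∩ Metric.closedBall x (2 * r)) := by
  have h1 : ∃ v ∈ J, t ≤ |v - x₀| := by
    by_contra! h
    have h2 := h z hz
    have h3 := h z' hz'
    have h4 := abs_sub_le z x₀ z'
    rw [abs_sub_comm x₀ z'] at h4
    linarith
  obtain ⟨v, hv, hvt⟩ := h1
  rw [abs_le] at hx
  rcases le_abs.1 hvt with h | h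
  · have hsub : Icc x₀ (x₀ + t) ⊆ J ∩ Metric.closedBall x (2 * r) := fun u hu =>
      ⟨hJ.out hx₀ hv ⟨hu.1, hu.2.trans (by linarith)⟩, by
        rw [Metric.mem_closedBall, Real.dist_eq, abs_le]
        constructor <;> linarith [hu.1, hu.2]⟩
    refine le_trans ?_ (MeasureTheory.measure_mono hsub)
    rw [Real.volume_Icc]
    simp
  · have hsub : Icc (x₀ - t) x₀ ⊆ J ∩ Metric.closedBall x (2 * r) := fun u hu =>
      ⟨hJ.out hv hx₀ ⟨le_trans (by linarith) hu.1, hu.2⟩, by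
        rw [Metric.mem_closedBall, Real.dist_eq, abs_le]
        constructor <;> linarith [hu.1, hu.2]⟩
    refine le_trans ?_ (MeasureTheory.measure_mono hsub)
    rw [Real.volume_Icc]
    simp

namespace ExpandingMarkovMap

variable {A : Type} {M : ExpandingMarkovMap A} {φ : ℝ → ℝ}

/-- Positivity of the pressure of `-s(ψ+φ)` provides a block length and Bernoulli weights
decaying strictly faster than the exponentials of the Birkhoff sums. -/
lemma Bounds.exists_weights [Finite A] (e : M.Bounds φ) {s : ℝ} (hs : 0 < s)
    (hP : 0 < M.pressure fun x => -s * (M.psi x + φ x)) :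
    ∃ p : ℕ, 0 < p ∧ ∃ a : ℝ, 0 < a ∧ ∃ q : (Fin p → A) → ℝ, (∀ b, 0 < q b) ∧
      ∑ᶠ b, q b = 1 ∧ ∀ b, ∀ x ∈ M.cyl (List.ofFn b) ∩ M.repeller,
        Real.log (q b) ≤ -s * (M.birkhoff M.psi p x + M.birkhoff φ p x) - a := by
  classical
  cases nonempty_fintype A
  obtain ⟨δ, hδ, hfreq⟩ := M.exists_frequently_lt_sum_of_pressure_pos hP
  obtain ⟨C, hC0, hC⟩ := e.R_small (δ / (8 * s)) (by positivity)
  obtain ⟨n₀, hn₀⟩ := exists_nat_ge (8 * s * C / δ)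
  obtain ⟨p, hpn, hp⟩ := frequently_atTop.1 hfreq (n₀ + 1)
  have hp0 : (0 : ℝ) < p := by exact_mod_cast (by omega : 0 < p)
  set f : (Fin p → A) → ℝ := fun b => M.birkhoffSup (fun x => -s * (M.psi x + φ x)) b with hf
  set Z := ∑ b, Real.exp (f b) with hZ
  rw [tsum_fintype, ← ENNReal.ofReal_sum_of_nonneg fun b _ => (Real.exp_pos _).le,
    ENNReal.ofReal_lt_ofReal_iff_of_nonneg (Real.exp_pos _).le] at hp
  have hZ0 : 0 < Z := (Real.exp_pos _).trans hp
  refine ⟨p, by omega, p * δ / 2, by positivity, fun b => Real.exp (f b) / Z,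
    fun b => div_pos (Real.exp_pos _) hZ0, ?_, fun b x hx => ?_⟩
  · rw [finsum_eq_sum_of_fintype, ← Finset.sum_div, div_self hZ0.ne']
  · rw [Real.log_div (Real.exp_pos _).ne' hZ0.ne', Real.log_exp]
    have h1 : δ * p ≤ Real.log Z := ((Real.lt_log_iff_exp_lt hZ0).2 hp).le
    have h2 : f b ≤ -s * (M.birkhoff M.psi p x + M.birkhoff φ p x) + s * (2 * e.R p) := by
      refine M.birkhoffSup_le fun x' hx' => ?_
      rw [M.birkhoff_neg_mul]
      have h3 := e.psi_dist _ x hx.1 x' hx'.1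
      have h4 := e.phi_dist _ x hx x' hx'
      rw [List.length_ofFn] at h3 h4
      rw [abs_le] at h3 h4
      nlinarith [h3.2, h4.2]
    have h3 : s * (2 * e.R p) ≤ δ * p / 2 := by
      have h4 := hC p
      have h5 : 8 * s * C ≤ δ * p := by
        have h6 : (n₀ : ℝ) ≤ p := by exact_mod_cast (by omega : n₀ ≤ p)
        have h7 := hn₀.trans h6
        rw [div_le_iff₀ hδ] at h7
        linarith
      have h8 : s * (2 * e.R p) ≤ s * (2 * (δ / (8 * s) * p + C)) := by gcongr
      have h9 : s * (2 * (δ / (8 * s) * p + C)) = δ * p / 4 + 2 * s * C := by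
        field_simp
        ring
      linarith
    linarith

open Classical in
/-- The word obtained by concatenating the blocks `ω 0, ω 1, …`, inserting the word `F τ` after
the word `τ` built so far at the times in `J`. -/
noncomputable def blockWord {p : ℕ} (F : List A → List A) (J : Set ℕ) (ω : ℕ → Fin p → A) :
    ℕ → List A
  | 0 => []
  | N + 1 => (blockWord F J ω N ++ List.ofFn (ω N)) ++
      if N + 1 ∈ J then F (blockWord F J ω N ++ List.ofFn (ω N)) else []

section BlockWord

variable {p : ℕ} {F : List A → List A} {J : Set ℕ} {ω : ℕ → Fin p → A} {N : ℕ}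

lemma blockWord_succ_of_mem (h : N + 1 ∈ J) : blockWord F J ω (N + 1) =
    (blockWord F J ω N ++ List.ofFn (ω N)) ++ F (blockWord F J ω N ++ List.ofFn (ω N)) := by
  rw [blockWord, if_pos h]

lemma blockWord_succ_of_notMem (h : N + 1 ∉ J) : blockWord F J ω (N + 1) =
    blockWord F J ω N ++ List.ofFn (ω N) := by
  rw [blockWord, if_neg h, List.append_nil]

lemma blockWord_congr {ω' : ℕ → Fin p → A} (h : ∀ i < N, ω i = ω' i) :
    blockWord F J ω N = blockWord F J ω' N := by
  induction N with
  | zero => rfl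
  | succ N ih => rw [blockWord, blockWord, ih fun i hi => h i (by omega), h N (by omega)]

lemma cyl_blockWord_succ_subset : M.cyl (blockWord F J ω (N + 1)) ⊆
    M.cyl (blockWord F J ω N ++ List.ofFn (ω N)) := by
  rw [blockWord]
  exact M.cyl_append_subset _ _

lemma cyl_blockWord_antitone : Antitone fun N => M.cyl (blockWord F J ω N) :=
  antitone_nat_of_succ_le fun _ => cyl_blockWord_succ_subset.trans (M.cyl_append_subset _ _)

lemma le_length_blockWord : p * N ≤ (blockWord F J ω N).length := by
  induction N with
  | zero => simp
  | succ N ih =>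
    rw [blockWord]
    simp only [List.length_append, List.length_ofFn]
    rw [Nat.mul_succ]
    omega

lemma exists_mem_cyl_blockWord (hp : 0 < p) (hJ : ∀ N, ∃ m, N ≤ m ∧ m + 1 ∈ J)
    (hF : ∀ τ, closure (M.cyl (τ ++ F τ)) ⊆ M.cyl τ) (ω : ℕ → Fin p → A) :
    ∃ x ∈ M.repeller, ∀ N, x ∈ M.cyl (blockWord F J ω N) := by
  choose m hm hmJ using hJ
  obtain ⟨g, hg⟩ : ∃ g : ℕ → ℕ, ∀ j, g (j + 1) = m (g j) + 1 :=
    ⟨fun j => Nat.rec 0 (fun _ k => m k + 1) j, fun _ => rfl⟩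
  have hmono : StrictMono g := strictMono_nat_of_lt_succ fun j => by
    have := hm (g j)
    rw [hg]
    omega
  obtain ⟨x, hx⟩ := M.exists_mem_of_nested (fun j => blockWord F J ω (g j)) fun j => by
    rw [hg, blockWord_succ_of_mem (hmJ _)]
    exact (hF _).trans ((M.cyl_append_subset _ _).trans (cyl_blockWord_antitone (hm (g j))))
  have hx' : ∀ N, x ∈ M.cyl (blockWord F J ω N) := fun N =>
    cyl_blockWord_antitone hmono.le_apply (hx N)
  refine ⟨x, M.mem_repeller_of_cyl fun n => ⟨_, ?_, hx' (n + 1)⟩, hx'⟩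
  refine lt_of_lt_of_le ?_ le_length_blockWord
  nlinarith

lemma mem_shrinkingTarget_of_mem_cyl_blockWord (hp : 0 < p)
    (hJ : ∀ N, ∃ m, N ≤ m ∧ m + 1 ∈ J) {y : ℝ}
    (hF : ∀ τ, ∀ x ∈ M.cyl (τ ++ F τ) ∩ M.repeller,
      |M.T^[τ.length] x - y| < Real.exp (-(M.birkhoff φ τ.length x)))
    {x : ℝ} (hx : x ∈ M.repeller) (h : ∀ N, x ∈ M.cyl (blockWord F J ω N)) :
    x ∈ M.shrinkingTarget y φ := by
  refine mem_iInter.2 fun n => ?_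
  obtain ⟨m, hm, hmJ⟩ := hJ n
  have h1 := h (m + 1)
  rw [blockWord_succ_of_mem hmJ] at h1
  refine mem_iUnion₂.2 ⟨_, ?_, hx, hF _ x ⟨h1, hx⟩⟩
  rw [List.length_append]
  have : p * m ≤ (blockWord F J ω m).length := le_length_blockWord
  nlinarith

end BlockWord

end ExpandingMarkovMap

namespace ExpandingMarkovMap

variable {A : Type} {M : ExpandingMarkovMap A} {φ : ℝ → ℝ}

lemma Bounds.exists_blockWord_estimate (e : M.Bounds φ) (hφ0 : ∀ x ∈ M.repeller, 0 ≤ φ x) {y : ℝ}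
    (hy : y ∈ closure M.repeller) {s : ℝ} (hs : 0 < s) {p : ℕ} {a : ℝ} (ha : 0 < a)
    {q : (Fin p → A) → ℝ}
    (hq : ∀ b, ∀ x ∈ M.cyl (List.ofFn b) ∩ M.repeller,
      Real.log (q b) ≤ -s * (M.birkhoff M.psi p x + M.birkhoff φ p x) - a) :
    ∃ (F : List A → List A) (J : Set ℕ) (c C : ℝ), 0 ≤ C ∧
      (∀ N, ∃ m, N ≤ m ∧ m + 1 ∈ J) ∧ (∀ τ, closure (M.cyl (τ ++ F τ)) ⊆ M.cyl τ) ∧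
      (∀ τ, ∀ x ∈ M.cyl (τ ++ F τ) ∩ M.repeller,
        |M.T^[τ.length] x - y| < Real.exp (-(M.birkhoff φ τ.length x))) ∧
      ∀ (ω : ℕ → Fin p → A), ∀ x ∈ M.repeller, (∀ N, x ∈ M.cyl (blockWord F J ω N)) → ∀ N,
        ∑ i ∈ Finset.range N, Real.log (q (ω i)) +
            s * M.birkhoff M.psi (blockWord F J ω N).length x ≤ -(a / 2) * N + c ∧
          ((blockWord F J ω N).length : ℝ) ≤ C * N := by
  obtain ⟨c, C, hc, hC, hF⟩ := e.exists_hitting_word hφ0 hy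
    (ε := a / (4 * s * (p + 1))) (by positivity)
  choose F hF1 hF2 hF3 using hF
  have hB := e.B_nonneg
  obtain ⟨J, hJ, hJ'⟩ := exists_sparse_set (p := p) (C' := 2 * s * e.B * C) ha hC (by positivity)
  refine ⟨F, J, s * c, (1 + p) * (1 + C) + C, by positivity, hJ, hF1,
    fun τ x hx => (hF3 τ x hx).1, fun ω x hx hxN => ?_⟩
  set W := blockWord F J ω with hW
  have hstep : ∀ N, Real.log (q (ω N)) + s * M.birkhoff M.psi ((W N).length + p) x +
      s * M.birkhoff φ ((W N).length + p) x ≤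
      s * M.birkhoff M.psi (W N).length x + s * M.birkhoff φ (W N).length x - a := fun N => by
    have h1 := ((M.mem_cyl_append _ _ _).1 (cyl_blockWord_succ_subset (hxN (N + 1)))).2
    have h2 := hq (ω N) _ ⟨h1, M.iterate_mem_repeller hx _⟩
    rw [← hW] at h2
    rw [M.birkhoff_add, M.birkhoff_add]
    linarith
  have hφmono : ∀ n m, M.birkhoff φ n x ≤ M.birkhoff φ (n + m) x := fun n m => by
    rw [M.birkhoff_add]
    exact le_add_of_nonneg_right (Finset.sum_nonneg fun l _ =>
      hφ0 _ (M.iterate_mem_repeller (M.iterate_mem_repeller hx n) l))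
  refine hJ' (fun N => (W N).length)
    (fun N => ∑ i ∈ Finset.range N, Real.log (q (ω i)) + s * M.birkhoff M.psi (W N).length x)
    (fun N => ∑ i ∈ Finset.range N, Real.log (q (ω i)) + s * M.birkhoff M.psi (W N).length x +
      s * M.birkhoff φ (W N).length x) (s * (a / (4 * s * (p + 1)))) (s * c)
    (by positivity) (by positivity) (le_of_eq (by field_simp)) rfl
    (by simp [hW, blockWord, birkhoff]) (by simp [hW, blockWord, birkhoff])
    (fun N hN => ?_) (fun N hN => ?_)
  · have hlen : (W (N + 1)).length = (W N).length + p := by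
      rw [hW, blockWord_succ_of_notMem hN, List.length_append, List.length_ofFn]
    have h1 := hstep N
    have h2 := mul_le_mul_of_nonneg_left (hφmono (W N).length p) hs.le
    simp only [hlen, Finset.sum_range_succ]
    refine ⟨trivial, ?_, ?_⟩ <;> linarith
  · set τ := W N ++ List.ofFn (ω N) with hτ
    have hτl : τ.length = (W N).length + p := by
      rw [hτ, List.length_append, List.length_ofFn]
    have hWN : W (N + 1) = τ ++ F τ := blockWord_succ_of_mem hN
    have hlen : (W (N + 1)).length = (W N).length + p + (F τ).length := by
      rw [hWN, List.length_append, hτl]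
    have hxτ : x ∈ M.cyl (τ ++ F τ) ∩ M.repeller := ⟨hWN ▸ hxN (N + 1), hx⟩
    have h1 := hstep N
    have h2 := (hF3 τ x hxτ).2
    have h3 := hF2 τ
    rw [hτl] at h2 h3
    have hT := M.iterate_mem_repeller hx ((W N).length + p)
    have h4 := (abs_le.1 (e.abs_psi_le_of_mem_repeller hT (F τ).length)).2
    have h5 := (abs_le.1 (e.abs_phi_le hT (F τ).length)).2
    push_cast at h2 h3
    simp only [hlen, Finset.sum_range_succ, M.birkhoff_add _ ((W N).length + p) (F τ).length]
    push_cast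
    have h6 := mul_le_mul_of_nonneg_left h2 hs.le
    have h7 : s * (M.birkhoff M.psi (F τ).length (M.T^[(W N).length + p] x) +
        M.birkhoff φ (F τ).length (M.T^[(W N).length + p] x)) ≤
        2 * s * e.B * C * ((W N).length + p + 1) := by
      calc _ ≤ s * ((F τ).length * e.B + (F τ).length * e.B) := by gcongr
        _ = 2 * s * e.B * (F τ).length := by ring
        _ ≤ 2 * s * e.B * (C * ((W N).length + p + 1)) := by gcongr
        _ = _ := by ring
    refine ⟨by linarith, by linarith, by linarith⟩

/-- The comparison, at the scale `r` separating two consecutive levels, between a weight and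
the length of a piece of the corresponding cylinder. -/
lemma Bounds.ofReal_exp_le_volume (e : M.Bounds φ) {s : ℝ} (hs : 0 < s) {u v w : List A} {p : ℕ}
    (hv : v.length = u.length + p) (hvu : M.cyl v ⊆ M.cyl u) {x₀ x r Q E : ℝ}
    (hx₀ : x₀ ∈ M.repeller) (hxv : x₀ ∈ M.cyl v) (hxw : x₀ ∈ M.cyl w) (hr : 0 < r)
    (hbig : ∃ z ∈ M.cyl u, ∃ z' ∈ M.cyl u, r < |z - z'|)
    (hsmall : ∀ z ∈ M.cyl w, ∀ z' ∈ M.cyl w, |z - z'| ≤ r) (hx : |x₀ - x| ≤ r)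
    (hE : E + s * M.birkhoff M.psi w.length x₀ + s * e.R w.length + e.R v.length +
      e.R u.length ≤ Q) :
    ENNReal.ofReal (Real.exp E) ≤
      ENNReal.ofReal (4 * 2 ^ s * Real.exp (Q + p * e.B) * r ^ (s - 1)) *
        MeasureTheory.volume (M.cyl v ∩ Metric.closedBall x (2 * r)) := by
  have hxu := hvu hxv
  have hq : ∀ u : List A, x₀ ∈ M.cyl u → ∃ z ∈ M.cyl u, ∃ z' ∈ M.cyl u,
      1 / 2 ≤ Real.exp (e.R u.length + M.birkhoff M.psi u.length x₀) * |z - z'| := by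
    intro u hu
    obtain ⟨z, hz, -, hz1⟩ := M.exists_preimage u (t := 1 / 4) (by norm_num)
    obtain ⟨z', hz', -, hz1'⟩ := M.exists_preimage u (t := 3 / 4) (by norm_num)
    refine ⟨z, hz, z', hz', ?_⟩
    have := e.abs_iterate_sub_le hz hz' hu
    rw [hz1, hz1'] at this
    norm_num [abs_of_neg] at this ⊢
    exact this
  set κ := Real.exp (-e.R v.length - e.R u.length - p * e.B) / 4 with hκ
  have hκ1 : κ ≤ 1 := by
    have h1 : Real.exp (-e.R v.length - e.R u.length - p * e.B) ≤ 1 := by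
      rw [Real.exp_le_one_iff]
      have := e.R_nonneg v.length
      have := e.R_nonneg u.length
      have : 0 ≤ p * e.B := mul_nonneg (Nat.cast_nonneg _) e.B_nonneg
      linarith
    linarith
  have hκ0 : 0 < κ := by positivity
  have hvol : ENNReal.ofReal (κ * r) ≤
      MeasureTheory.volume (M.cyl v ∩ Metric.closedBall x (2 * r)) := by
    obtain ⟨z, hz, z', hz', h⟩ := hq v hxv
    refine ofReal_le_volume_inter_closedBall (M.ordConnected_cyl v) hxv hz hz' ?_
      (by nlinarith) hx
    obtain ⟨w, hw, w', hw', hww⟩ := hbig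
    have h1 := hww.le.trans (e.abs_sub_le_exp hw hw' hxu)
    have h2 := (abs_le.1 (e.abs_psi_le_of_mem_repeller
      (M.iterate_mem_repeller hx₀ u.length) p)).2
    rw [hv, M.birkhoff_add, ← hv] at h
    have h3 : Real.exp (e.R v.length + (M.birkhoff M.psi u.length x₀ +
        M.birkhoff M.psi p (M.T^[u.length] x₀))) ≤
        Real.exp (e.R v.length + (M.birkhoff M.psi u.length x₀ + p * e.B)) := by gcongr
    have h4 : 1 / 2 ≤ Real.exp (e.R v.length + (M.birkhoff M.psi u.length x₀ + p * e.B)) *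
        |z - z'| := h.trans (by gcongr)
    calc 2 * (κ * r) ≤ 2 * (κ * Real.exp (e.R u.length - M.birkhoff M.psi u.length x₀)) := by
          gcongr
      _ = Real.exp (-(e.R v.length + (M.birkhoff M.psi u.length x₀ + p * e.B))) * (1 / 2) := by
          rw [hκ, div_mul_eq_mul_div, ← Real.exp_add]
          ring_nf
      _ ≤ Real.exp (-(e.R v.length + (M.birkhoff M.psi u.length x₀ + p * e.B))) *
          (Real.exp (e.R v.length + (M.birkhoff M.psi u.length x₀ + p * e.B)) * |z - z'|) := by
          gcongr
      _ = |z - z'| := by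
          rw [← mul_assoc, ← Real.exp_add, neg_add_cancel, Real.exp_zero, one_mul]
  refine le_trans ?_ (mul_le_mul_right hvol _)
  rw [← ENNReal.ofReal_mul (by positivity)]
  apply ENNReal.ofReal_le_ofReal
  have hexp : Real.exp (-(M.birkhoff M.psi w.length x₀)) ≤ 2 * r * Real.exp (e.R w.length) := by
    obtain ⟨z, hz, z', hz', h⟩ := hq w hxw
    have h1 : 1 / 2 ≤ Real.exp (e.R w.length + M.birkhoff M.psi w.length x₀) * r :=
      h.trans (by gcongr; exact hsmall z hz z' hz')
    rw [Real.exp_add] at h1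
    rw [Real.exp_neg, inv_le_iff_one_le_mul₀ (Real.exp_pos _)]
    linarith
  have hpow := Real.rpow_le_rpow (Real.exp_pos _).le hexp hs.le
  rw [Real.mul_rpow (by positivity) (Real.exp_pos _).le, Real.mul_rpow (by norm_num) hr.le,
    ← Real.exp_mul, ← Real.exp_mul] at hpow
  have hrs : r ^ s = r ^ (s - 1) * r := by
    rw [← Real.rpow_add_one hr.ne']
    simp
  calc Real.exp E
      ≤ Real.exp (-(M.birkhoff M.psi w.length x₀) * s + (Q - s * e.R w.length - e.R v.length -
          e.R u.length)) := Real.exp_le_exp.2 (by linarith)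
    _ = Real.exp (-(M.birkhoff M.psi w.length x₀) * s) * Real.exp (Q - s * e.R w.length -
          e.R v.length - e.R u.length) := Real.exp_add _ _
    _ ≤ (2 ^ s * r ^ s * Real.exp (e.R w.length * s)) * Real.exp (Q - s * e.R w.length -
          e.R v.length - e.R u.length) := by gcongr
    _ = 2 ^ s * r ^ s * Real.exp (Q - e.R v.length - e.R u.length) := by
        rw [mul_assoc, ← Real.exp_add]
        ring_nf
    _ = 4 * 2 ^ s * Real.exp (Q + p * e.B) * r ^ (s - 1) * (κ * r) := by
        have h1 : Real.exp (Q - e.R v.length - e.R u.length) = Real.exp (Q + p * e.B) *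
            Real.exp (-e.R v.length - e.R u.length - p * e.B) := by
          rw [← Real.exp_add]
          ring_nf
        rw [h1, hκ, hrs]
        ring

lemma Bounds.le_dimH_shrinkingTarget [Finite A] (e : M.Bounds φ)
    (hφ0 : ∀ x ∈ M.repeller, 0 ≤ φ x) {y : ℝ} (hy : y ∈ closure M.repeller) {s : ℝ} (hs : 0 < s)
    (hP : 0 < M.pressure fun x => -s * (M.psi x + φ x)) :
    ENNReal.ofReal s ≤ dimH (M.shrinkingTarget y φ) := by
  classical
  cases nonempty_fintype A
  obtain ⟨p, hp, a, ha, q, hq0, hq1, hq⟩ := e.exists_weights hs hP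
  rw [finsum_eq_sum_of_fintype] at hq1
  obtain ⟨F, J, c, C, hC, hJ, hF1, hF2, hest⟩ := e.exists_blockWord_estimate hφ0 hy hs ha hq
  choose π hπΛ hπ using exists_mem_cyl_blockWord (M := M) hp hJ hF1
  obtain ⟨i₀, -⟩ := M.nontriv
  obtain ⟨D, hD0, hD⟩ := e.R_small (a / (2 * (s + 2) * (C + 1))) (by positivity)
  set ε := a / (2 * (s + 2) * (C + 1)) with hε
  have hε0 : 0 < ε := by positivity
  have hεC : (s + 2) * (ε * C) ≤ a / 2 := by
    have h1 : (s + 2) * (ε * (C + 1)) = a / 2 := by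
      rw [hε]
      field_simp
    nlinarith
  set Q := c + (s + 2) * (ε * p + D) with hQ
  have : Nonempty (Fin p → A) := ⟨fun _ => i₀⟩
  refine ofReal_le_dimH_of_nested (fun b => (hq0 b).le) hq1 hs
    (K := 4 * 2 ^ s * Real.exp (Q + p * e.B)) (by positivity)
    (fun ω N => M.cyl (blockWord F J ω N))
    (fun ω N => M.cyl (blockWord F J ω N ++ List.ofFn (ω N))) π
    (fun N ω ω' h => by rw [blockWord_congr h])
    (fun N ω ω' h => by rw [blockWord_congr fun i hi => h i (by omega), h N (by omega)])
    (fun ω N => cyl_blockWord_succ_subset) (fun ω N => M.cyl_append_subset _ _)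
    (fun N ω ω' h hne => ?_) (fun ω N => (M.ordConnected_cyl _).measurableSet) hπ
    (fun r hr => ?_) (fun ω => rfl) (fun ω N x r hr hr1 hbig hsmall hx => ?_) ?_
  · rw [blockWord_congr h]
    refine M.disjoint_cyl _ _ (by simp) fun heq => hne ?_
    exact List.ofFn_injective (List.append_cancel_left heq)
  · obtain ⟨n₀, hn₀⟩ := e.exists_small hr
    refine ⟨n₀, fun N hN ω z hz z' hz' => (hn₀ _ ?_ z hz z' hz').le⟩
    refine le_trans ?_ le_length_blockWord
    nlinarith
  · have hprod : ∏ i ∈ Finset.range (N + 1), q (ω i) =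
        Real.exp (∑ i ∈ Finset.range (N + 1), Real.log (q (ω i))) := by
      rw [Real.exp_sum]
      exact Finset.prod_congr rfl fun i _ => (Real.exp_log (hq0 _)).symm
    rw [hprod]
    have h1 := (hest ω (π ω) (hπΛ ω) (hπ ω) N).2
    have h2 := hest ω (π ω) (hπΛ ω) (hπ ω) (N + 1)
    have hlen : (blockWord F J ω N ++ List.ofFn (ω N)).length = (blockWord F J ω N).length + p := by
      simp
    refine e.ofReal_exp_le_volume hs hlen (M.cyl_append_subset _ _) (hπΛ ω)
      (cyl_blockWord_succ_subset (hπ ω (N + 1))) (hπ ω (N + 1)) hr hbig hsmall hx ?_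
    have h3 := hD (blockWord F J ω N).length
    have h4 := hD (blockWord F J ω (N + 1)).length
    have h5 := hD (blockWord F J ω N ++ List.ofFn (ω N)).length
    rw [hlen] at h5 ⊢
    push_cast at h2 h5
    have hp0 : (0 : ℝ) ≤ p := Nat.cast_nonneg p
    have hb : ∀ {k : ℝ}, k ≤ C * (N + 1) + p → ε * k + D ≤ ε * C * (N + 1) + (ε * p + D) :=
      fun {k} hk => by nlinarith
    have h3' := h3.trans (hb (by linarith))
    have h4' := h4.trans (hb (by linarith))
    have h5' := h5.trans (hb (by linarith))
    have h6 := mul_le_mul_of_nonneg_left h4' hs.le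
    have h7 : (s + 2) * (ε * C) * (N + 1) ≤ a / 2 * (N + 1) := by gcongr
    rw [hQ]
    linarith [h2.1]
  · rintro _ ⟨ω, rfl⟩
    exact mem_shrinkingTarget_of_mem_cyl_blockWord hp hJ hF2 (hπΛ ω) (hπ ω)

lemma Bounds.sdim_le_dimH_shrinkingTarget [Finite A] (e : M.Bounds φ)
    (hφ0 : ∀ x ∈ M.repeller, 0 ≤ φ x) {y : ℝ} (hy : y ∈ closure M.repeller) :
    ENNReal.ofReal (M.sdim φ) ≤ dimH (M.shrinkingTarget y φ) := by
  by_cases hbdd : BddBelow {s : ℝ | M.pressure (fun x => -s * (M.psi x + φ x)) ≤ 0}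
  · refine le_of_forall_lt_imp_le_of_dense fun t ht => ?_
    rcases eq_or_ne t 0 with rfl | h0
    · exact zero_le
    have htop : t ≠ ⊤ := ht.ne_top
    have ht' := (ENNReal.lt_ofReal_iff_toReal_lt htop).1 ht
    rw [← ENNReal.ofReal_toReal htop]
    refine e.le_dimH_shrinkingTarget hφ0 hy (ENNReal.toReal_pos h0 htop) (not_le.1 fun h => ?_)
    exact notMem_of_lt_csInf ht' hbdd h
  · rw [sdim, Real.sInf_of_not_bddBelow hbdd]
    simp

end ExpandingMarkovMap

/-- **Hill–Velani.** For a finite branch expanding Markov map and a non-negative potential `φ`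
satisfying the tempered distortion condition, `dim D_y(φ) = s(φ)` for all `y ∈ closure Λ`. -/
theorem dimH_shrinkingTarget_eq_of_finite {A : Type} [Finite A] (M : ExpandingMarkovMap A)
    (φ : ℝ → ℝ) (hφ0 : ∀ x ∈ M.repeller, 0 ≤ φ x) (hφ : M.Tempered φ)
    (y : ℝ) (hy : y ∈ closure M.repeller) :
    dimH (M.shrinkingTarget y φ) = ENNReal.ofReal (M.sdim φ) := by
  obtain ⟨e⟩ := M.exists_bounds hφ
  exact le_antisymm (ExpandingMarkovMap.Bounds.dimH_shrinkingTarget_le_sdim hφ0 e y)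
    (e.sdim_le_dimH_shrinkingTarget hφ0 hy)
end

section
/- For every α > 2, the Hausdorff dimension of J(α) := {x ∈ [0,1] : |x − p/q| < q^{−α} for infinitely many p,q ∈ ℕ} equals 2/α. -/
open Set Filter Topology

/-- The Jarník set `J(α)`: points of `[0,1]` with `|x - p/q| < q^{-α}` for infinitely many
pairs of natural numbers `p, q`. -/
def JSet (α : ℝ) : Set ℝ :=
  {x ∈ Set.Icc (0:ℝ) 1 |
    {pq : ℕ × ℕ | |x - (pq.1 : ℝ) / (pq.2 : ℝ)| < (pq.2 : ℝ) ^ (-α)}.Infinite}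

section UpperBound

open MeasureTheory

lemma JSet.exists_approx {α x : ℝ} (hα : 0 < α) (hx : x ∈ JSet α) (n : ℕ) :
    ∃ p q : ℕ, n ≤ q ∧ p < 2 * q + 1 ∧ |x - (p : ℝ) / q| < (q : ℝ) ^ (-α) := by
  obtain ⟨hx01, hinf⟩ := hx
  by_contra! hcon
  refine hinf (((Set.finite_Iio (2 * n + 1)).prod (Set.finite_Iio n)).subset ?_)
  rintro ⟨p, q⟩ hpq
  rw [mem_ofPred_eq] at hpq
  have hq : 0 < q := by
    rcases Nat.eq_zero_or_pos q with rfl | h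
    · rw [Nat.cast_zero, Real.zero_rpow (by linarith)] at hpq
      exact absurd hpq (not_lt.2 (abs_nonneg _))
    · exact h
  have hq' : (1 : ℝ) ≤ q := by exact_mod_cast hq
  have h1 : (q : ℝ) ^ (-α) ≤ 1 := Real.rpow_le_one_of_one_le_of_nonpos hq' (by linarith)
  have h2 : (p : ℝ) / q < 2 := by
    have := (abs_lt.1 hpq).1
    linarith [hx01.2]
  have h3 : p < 2 * q := by
    rw [div_lt_iff₀ (by linarith)] at h2
    exact_mod_cast h2
  have h4 : q < n := by
    by_contra! h
    exact absurd hpq (not_lt.2 (hcon p q h (by omega)))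
  exact ⟨show p < 2 * n + 1 by omega, h4⟩

lemma ediam_ball_le_ofReal (x r : ℝ) :
    Metric.ediam (Metric.ball x r) ≤ ENNReal.ofReal (2 * r) := by
  rw [Real.ball_eq_Ioo, Real.ediam_Ioo]
  exact ENNReal.ofReal_le_ofReal (by linarith)

lemma tsum_ofReal_rpow_ne_top {α d : ℝ} (hd : 0 < d) (h : 2 < α * d) :
    ∑' i : (Σ q : ℕ, Fin (2 * q + 1)), ENNReal.ofReal (2 * (i.1 : ℝ) ^ (-α)) ^ d ≠ ⊤ := by
  rw [ENNReal.tsum_sigma']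
  have hterm : ∀ q : ℕ, ∑' _ : Fin (2 * q + 1), ENNReal.ofReal (2 * (q : ℝ) ^ (-α)) ^ d
      ≤ ENNReal.ofReal (3 * 2 ^ d * (q : ℝ) ^ (1 - α * d)) := by
    intro q
    rw [tsum_fintype, Finset.sum_const, Finset.card_univ, Fintype.card_fin, nsmul_eq_mul,
      ENNReal.ofReal_rpow_of_nonneg (by positivity) hd.le,
      Real.mul_rpow (by norm_num) (by positivity), ← Real.rpow_mul (by positivity),
      ← ENNReal.ofReal_natCast, ← ENNReal.ofReal_mul (by positivity)]
    apply ENNReal.ofReal_le_ofReal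
    rcases Nat.eq_zero_or_pos q with rfl | hq
    · rw [Nat.cast_zero, Real.zero_rpow (by nlinarith), Real.zero_rpow (by nlinarith)]
      simp
    · have hq' : (1 : ℝ) ≤ q := by exact_mod_cast hq
      rw [show (1 : ℝ) - α * d = 1 + (-α * d) by ring, Real.rpow_add (by linarith), Real.rpow_one]
      push_cast
      have : 0 ≤ (2 : ℝ) ^ d * (q : ℝ) ^ (-α * d) := by positivity
      nlinarith
  refine ne_top_of_le_ne_top ?_ (ENNReal.tsum_le_tsum hterm)
  have hs : Summable fun q : ℕ => 3 * 2 ^ d * (q : ℝ) ^ (1 - α * d) :=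
    (Real.summable_nat_rpow.2 (by linarith)).mul_left _
  exact hs.tsum_ofReal_ne_top

lemma hausdorffMeasure_JSet_ne_top {α d : ℝ} (hα : 0 < α) (hd : 0 < d) (h : 2 < α * d) :
    Measure.hausdorffMeasure d (JSet α) ≠ ⊤ := by
  let t : ℕ → (Σ q : ℕ, Fin (2 * q + 1)) → Set ℝ := fun n i =>
    if n ≤ i.1 then Metric.ball ((i.2 : ℕ) / (i.1 : ℝ)) ((i.1 : ℝ) ^ (-α)) else ∅
  have htd : ∀ n i, Metric.ediam (t n i) ≤ ENNReal.ofReal (2 * (i.1 : ℝ) ^ (-α)) := by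
    intro n i
    by_cases hi : n ≤ i.1
    · simpa only [t, if_pos hi] using ediam_ball_le_ofReal _ _
    · simp [t, if_neg hi]
  have hr : Tendsto (fun n : ℕ => ENNReal.ofReal (2 * (n : ℝ) ^ (-α))) atTop (𝓝 0) := by
    rw [← ENNReal.ofReal_zero]
    refine ENNReal.tendsto_ofReal ?_
    simpa using ((tendsto_rpow_neg_atTop hα).comp tendsto_natCast_atTop_atTop).const_mul 2
  have key := Measure.hausdorffMeasure_le_liminf_tsum d (JSet α) (l := atTop)
    (fun n : ℕ => ENNReal.ofReal (2 * (n : ℝ) ^ (-α))) hr t ?_ ?_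
  · refine ne_top_of_le_ne_top (tsum_ofReal_rpow_ne_top hd h) (key.trans ?_)
    refine (liminf_le_liminf (Eventually.of_forall fun n =>
      ENNReal.tsum_le_tsum fun i => ENNReal.rpow_le_rpow (htd n i) hd.le)).trans ?_
    rw [liminf_const]
  · filter_upwards [eventually_ge_atTop 1] with n hn i
    by_cases hi : n ≤ i.1
    · refine (htd n i).trans (ENNReal.ofReal_le_ofReal ?_)
      have : (i.1 : ℝ) ^ (-α) ≤ (n : ℝ) ^ (-α) :=
        Real.rpow_le_rpow_of_nonpos (by exact_mod_cast hn) (by exact_mod_cast hi) (by linarith)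
      linarith
    · simp [t, if_neg hi]
  · refine Eventually.of_forall fun n x hx => ?_
    obtain ⟨p, q, hq, hp, hpq⟩ := JSet.exists_approx hα hx n
    refine mem_iUnion.2 ⟨⟨q, p, hp⟩, ?_⟩
    simpa [t, if_pos hq, Real.dist_eq] using hpq

lemma dimH_JSet_le {α : ℝ} (hα : 0 < α) : dimH (JSet α) ≤ ENNReal.ofReal (2 / α) := by
  refine ENNReal.le_of_forall_pos_le_add fun ε hε _ => ?_
  have h2 : 0 ≤ 2 / α := by positivity
  have hd : (Real.toNNReal (2 / α) + ε : NNReal) = 2 / α + ε := by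
    rw [NNReal.coe_add, Real.coe_toNNReal _ h2]
  have hε' : (0 : ℝ) < ε := hε
  have := dimH_le_of_hausdorffMeasure_ne_top (s := JSet α) (d := Real.toNNReal (2 / α) + ε) (by
    rw [hd]
    refine hausdorffMeasure_JSet_ne_top hα (by positivity) ?_
    rw [mul_add, mul_div_cancel₀ _ hα.ne']
    have := mul_pos hα hε'
    linarith)
  simpa [ENNReal.ofReal] using this

end UpperBound

section MassDistribution

open MeasureTheory

/-- A set of reals of finite diameter lies in an open interval that is barely longer. -/
lemma exists_subset_Ioo_rpow_le {s : ℝ} (hs : 0 < s) {t : Set ℝ} (ht : t.Nonempty)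
    (hd : Metric.ediam t ≠ ⊤) {ε : ENNReal} (hε : ε ≠ 0) :
    ∃ a b : ℝ, a < b ∧ t ⊆ Ioo a b ∧ ENNReal.ofReal ((b - a) ^ s) ≤ Metric.ediam t ^ s + ε := by
  set D := (Metric.ediam t).toReal with hD
  have hD0 : 0 ≤ D := ENNReal.toReal_nonneg
  have hed : Metric.ediam t = ENNReal.ofReal D := (ENNReal.ofReal_toReal hd).symm
  have hcont : Continuous fun e : ℝ => ENNReal.ofReal ((D + 2 * e) ^ s) := by
    refine ENNReal.continuous_ofReal.comp ?_
    exact (by fun_prop : Continuous fun e : ℝ => D + 2 * e).rpow_const fun _ => Or.inr hs.le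
  have hlt : ENNReal.ofReal ((D + 2 * 0) ^ s) < Metric.ediam t ^ s + ε := by
    rw [mul_zero, add_zero, ← ENNReal.ofReal_rpow_of_nonneg hD0 hs.le, ← hed]
    exact ENNReal.lt_add_right (ENNReal.rpow_ne_top_of_nonneg hs.le hd) hε
  obtain ⟨e, he, he0⟩ := (((hcont.tendsto 0).eventually (gt_mem_nhds hlt)).filter_mono
    nhdsWithin_le_nhds |>.and (self_mem_nhdsWithin (s := Ioi (0 : ℝ)))).exists
  have he0 : 0 < e := he0
  have hdist : ∀ x ∈ t, ∀ y ∈ t, |x - y| ≤ D := by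
    intro x hx y hy
    rw [← Real.dist_eq]
    exact Metric.dist_le_diam_of_mem' hd hx hy
  obtain ⟨x₀, hx₀⟩ := ht
  have hbdd : BddBelow t := ⟨x₀ - D, fun y hy => by linarith [(abs_le.1 (hdist x₀ hx₀ y hy)).2]⟩
  refine ⟨sInf t - e, sInf t + D + e, by linarith, fun x hx => ⟨?_, ?_⟩, ?_⟩
  · linarith [csInf_le hbdd hx]
  · have : x - D ≤ sInf t := le_csInf ⟨x₀, hx₀⟩ fun y hy => by
      linarith [(abs_le.1 (hdist x hx y hy)).2]
    linarith
  · rw [show sInf t + D + e - (sInf t - e) = D + 2 * e by ring]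
    exact he.le

/-- Mass distribution principle for a nested sequence of compact sets, each of which carries a
measure satisfying the same Frostman estimate. -/
lemma hausdorffMeasure_iInter_ne_zero {s : ℝ} (hs : 0 < s) {K : ℕ → Set ℝ}
    (hK : Antitone K) (hKc : ∀ n, IsCompact (K n)) (μ : ℕ → Measure ℝ)
    (hμK : ∀ n, μ n (K n)ᶜ = 0) {c C : ENNReal} (hc : c ≠ 0) (hC : C ≠ ⊤)
    (hμc : ∀ n, c ≤ μ n univ)
    (hμ : ∀ n a b, a < b → μ n (Ioo a b) ≤ C * ENNReal.ofReal ((b - a) ^ s)) :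
    Measure.hausdorffMeasure s (⋂ n, K n) ≠ 0 := by
  intro h0
  rw [Measure.hausdorffMeasure_apply] at h0
  have h1 : ⨅ (t : ℕ → Set ℝ) (_ : (⋂ n, K n) ⊆ ⋃ n, t n) (_ : ∀ n, Metric.ediam (t n) ≤ 1),
      ∑' n, ⨆ _ : (t n).Nonempty, Metric.ediam (t n) ^ s ≤ 0 := by
    rw [← h0]
    exact le_iSup₂ (f := fun (r : ENNReal) (_ : 0 < r) =>
      ⨅ (t : ℕ → Set ℝ) (_ : (⋂ n, K n) ⊆ ⋃ n, t n) (_ : ∀ n, Metric.ediam (t n) ≤ r),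
        ∑' n, ⨆ _ : (t n).Nonempty, Metric.ediam (t n) ^ s) 1 one_pos
  obtain ⟨c', hc'0, hc'⟩ : ∃ c', 0 < c' ∧ C * (c' + c') < c := by
    have hcont : Tendsto (fun x : ENNReal => C * (x + x)) (𝓝 0) (𝓝 (C * (0 + 0))) :=
      ENNReal.Tendsto.const_mul (tendsto_id.add tendsto_id) (Or.inr hC)
    rw [add_zero, mul_zero] at hcont
    obtain ⟨x, hx, hx0⟩ := (((hcont.eventually (gt_mem_nhds (pos_iff_ne_zero.2 hc))).filter_mono
      nhdsWithin_le_nhds).and (self_mem_nhdsWithin (s := Ioi (0 : ENNReal)))).exists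
    exact ⟨x, hx0, hx⟩
  have h2 := h1.trans_lt hc'0
  simp only [iInf_lt_iff] at h2
  obtain ⟨t, hcov, hdiam, hsum⟩ := h2
  obtain ⟨ε, hε0, hεsum⟩ := ENNReal.exists_pos_sum_of_countable' hc'0.ne' ℕ
  have hU : ∀ n, ∃ U : Set ℝ, IsOpen U ∧ t n ⊆ U ∧
      ∀ k, μ k U ≤ C * ((⨆ _ : (t n).Nonempty, Metric.ediam (t n) ^ s) + ε n) := by
    intro n
    rcases (t n).eq_empty_or_nonempty with he | hne
    · exact ⟨∅, isOpen_empty, he.subset, fun k => by simp⟩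
    · obtain ⟨a, b, hab, hsub, hle⟩ := exists_subset_Ioo_rpow_le hs hne
        (ne_top_of_le_ne_top ENNReal.one_ne_top (hdiam n)) (hε0 n).ne'
      refine ⟨Ioo a b, isOpen_Ioo, hsub, fun k => (hμ k a b hab).trans ?_⟩
      rw [ciSup_pos hne]
      gcongr
  choose U hUo htU hμU using hU
  obtain ⟨k, hk⟩ := exists_subset_nhds_of_isCompact (U := ⋃ n, U n) (directed_of_isDirected_le hK)
    hKc fun x hx => (isOpen_iUnion hUo).mem_nhds ((hcov.trans (iUnion_mono htU)) hx)
  refine absurd (hμc k) (not_le.2 (lt_of_le_of_lt ?_ hc'))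
  calc μ k univ ≤ μ k (K k) + μ k (K k)ᶜ := by
        rw [← union_compl_self (K k)]; exact measure_union_le _ _
    _ = μ k (K k) := by rw [hμK, add_zero]
    _ ≤ μ k (⋃ n, U n) := measure_mono hk
    _ ≤ ∑' n, μ k (U n) := measure_iUnion_le _
    _ ≤ ∑' n, C * ((⨆ _ : (t n).Nonempty, Metric.ediam (t n) ^ s) + ε n) :=
        ENNReal.tsum_le_tsum fun n => hμU n k
    _ = C * ((∑' n, ⨆ _ : (t n).Nonempty, Metric.ediam (t n) ^ s) + ∑' n, ε n) := by
        rw [ENNReal.tsum_mul_left, ENNReal.tsum_add]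
    _ ≤ C * (c' + c') := by gcongr

end MassDistribution

section Oscillation

open intervalIntegral

lemma abs_integral_mul_sub_integral_le {g : ℝ → ℝ} (hg : ContDiff ℝ 1 g) :
    ∃ D : ℝ, 0 < D ∧ ∀ (F : ℝ → ℝ) (η : ℝ), Continuous F →
      (∀ x ∈ Icc (0 : ℝ) 1, |(∫ y in (0 : ℝ)..x, F y) - x| ≤ η) →
      ∀ a b : ℝ, 0 ≤ a → a ≤ b → b ≤ 1 →
        |(∫ y in a..b, g y * F y) - ∫ y in a..b, g y| ≤ D * η := by
  obtain ⟨B, hB⟩ := (isCompact_Icc (a := (0 : ℝ)) (b := 1)).exists_bound_of_continuousOn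
    hg.continuous.continuousOn
  have hg' : Continuous (deriv g) := hg.continuous_deriv le_rfl
  obtain ⟨B', hB'⟩ := (isCompact_Icc (a := (0 : ℝ)) (b := 1)).exists_bound_of_continuousOn
    hg'.continuousOn
  have hB0 : 0 ≤ B := (norm_nonneg _).trans (hB 0 (by simp))
  have hB0' : 0 ≤ B' := (norm_nonneg _).trans (hB' 0 (by simp))
  refine ⟨2 * B + B' + 1, by positivity, fun F η hF hE a b ha hab hb => ?_⟩
  have hη : 0 ≤ η := (abs_nonneg _).trans (hE 0 (by simp))
  set E : ℝ → ℝ := fun x => (∫ y in (0 : ℝ)..x, F y) - x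
  have hEd : ∀ x, HasDerivAt E (F x - 1) x := fun x =>
    (hF.integral_hasStrictDerivAt 0 x).hasDerivAt.sub (hasDerivAt_id x)
  have hgd : ∀ x, HasDerivAt g (deriv g x) x := fun x =>
    ((hg.differentiable one_ne_zero) x).hasDerivAt
  have hparts := integral_mul_deriv_eq_deriv_mul (a := a) (b := b)
    (fun x _ => hgd x) (fun x _ => hEd x) (hg'.intervalIntegrable a b)
    ((hF.sub continuous_const).intervalIntegrable a b)
  have hdiff : (∫ y in a..b, g y * F y) - ∫ y in a..b, g y = ∫ y in a..b, g y * (F y - 1) := by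
    rw [← integral_sub (f := fun y => g y * F y) ((hg.continuous.mul hF).intervalIntegrable _ _)
      (hg.continuous.intervalIntegrable _ _)]
    congr 1 with y
    ring
  rw [hdiff, hparts]
  have hmem : ∀ x, a ≤ x → x ≤ b → x ∈ Icc (0 : ℝ) 1 := fun x h h' => ⟨by linarith, by linarith⟩
  have hbd : ∀ x, a ≤ x → x ≤ b → |g x * E x| ≤ B * η := fun x h h' => by
    rw [abs_mul]
    exact mul_le_mul (hB x (hmem x h h')) (hE x (hmem x h h')) (abs_nonneg _) hB0
  have hint : |∫ x in a..b, deriv g x * E x| ≤ B' * η := by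
    have := norm_integral_le_of_norm_le_const (a := a) (b := b) (C := B' * η)
      (f := fun x => deriv g x * E x) fun x hx => by
        rw [uIoc_of_le hab] at hx
        rw [norm_mul]
        exact mul_le_mul (hB' x (hmem x hx.1.le hx.2)) (hE x (hmem x hx.1.le hx.2))
          (norm_nonneg _) hB0'
    rw [Real.norm_eq_abs, abs_of_nonneg (by linarith : 0 ≤ b - a)] at this
    have h0 : 0 ≤ B' * η := by positivity
    nlinarith
  have h1 := abs_le.1 (hbd a le_rfl hab)
  have h2 := abs_le.1 (hbd b hab le_rfl)
  have h3 := abs_le.1 hint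
  rw [abs_le]
  constructor <;> nlinarith

end Oscillation

section Staircase

open Real (smoothTransition)

lemma exists_smoothTransition_sub_le :
    ∃ A : ℝ, 1 ≤ A ∧ ∀ x y, x ≤ y → smoothTransition y - smoothTransition x ≤ A * (y - x) := by
  have hcd : ContDiff ℝ 1 smoothTransition := smoothTransition.contDiff
  obtain ⟨B, hB⟩ := (isCompact_Icc (a := (0 : ℝ)) (b := 1)).exists_bound_of_continuousOn
    (hcd.continuous_deriv le_rfl).continuousOn
  refine ⟨max B 1, le_max_right _ _, fun x y hxy => ?_⟩
  have hder : ∀ z, ‖deriv smoothTransition z‖ ≤ max B 1 := by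
    intro z
    rcases lt_or_ge z 0 with hz | hz
    · have : smoothTransition =ᶠ[𝓝 z] fun _ => 0 := by
        filter_upwards [gt_mem_nhds hz] with w hw using smoothTransition.zero_of_nonpos hw.le
      rw [this.deriv_eq]
      simp
    rcases le_or_gt z 1 with hz' | hz'
    · exact (hB z ⟨hz, hz'⟩).trans (le_max_left _ _)
    · have : smoothTransition =ᶠ[𝓝 z] fun _ => 1 := by
        filter_upwards [lt_mem_nhds hz'] with w hw using smoothTransition.one_of_one_le hw.le
      rw [this.deriv_eq]
      simp
  have := Convex.norm_image_sub_le_of_norm_deriv_le (s := univ) (x := x) (y := y)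
    (fun z _ => (hcd.differentiable one_ne_zero) z) (fun z _ => hder z) convex_univ
    (mem_univ _) (mem_univ _)
  rw [Real.norm_eq_abs, Real.norm_eq_abs, abs_of_nonneg (sub_nonneg.2 hxy)] at this
  exact (le_abs_self _).trans this

/-- A `δ`-separated family in an open interval of length `v - u` has at most `(v - u) / δ + 1`
members. -/
lemma card_le_of_separated {ι : Type*} (T : Finset ι) (f : ι → ℝ) {δ u v : ℝ} (hδ : 0 < δ)
    (huv : u ≤ v) (hT : ∀ i ∈ T, u < f i ∧ f i < v)
    (hsep : ∀ i ∈ T, ∀ j ∈ T, i ≠ j → δ ≤ |f i - f j|) :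
    (T.card : ℝ) ≤ (v - u) / δ + 1 := by
  have hcard : T.card ≤ (Finset.range (⌊(v - u) / δ⌋₊ + 1)).card := by
    refine Finset.card_le_card_of_injOn (fun i => ⌊(f i - u) / δ⌋₊) (fun i hi => ?_) ?_
    · have hi := hT i hi
      refine Finset.mem_coe.2 (Finset.mem_range.2 (Nat.lt_succ_of_le (Nat.floor_mono ?_)))
      gcongr
      exact hi.2.le
    · intro i hi j hj hij
      by_contra hne
      have h1 := hsep i hi j hj hne
      have hi0 : 0 ≤ (f i - u) / δ := div_nonneg (by linarith [(hT i hi).1]) hδ.le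
      have hj0 : 0 ≤ (f j - u) / δ := div_nonneg (by linarith [(hT j hj).1]) hδ.le
      have hij' : ((⌊(f i - u) / δ⌋₊ : ℕ) : ℝ) = (⌊(f j - u) / δ⌋₊ : ℕ) := by exact_mod_cast hij
      have a1 := Nat.floor_le hi0
      have a2 := Nat.lt_floor_add_one ((f i - u) / δ)
      have b1 := Nat.floor_le hj0
      have b2 := Nat.lt_floor_add_one ((f j - u) / δ)
      have h2 : |(f i - u) / δ - (f j - u) / δ| < 1 := by
        rw [abs_lt]
        constructor <;> linarith
      rw [← sub_div, abs_div, abs_of_pos hδ, div_lt_one hδ] at h2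
      rw [show f i - u - (f j - u) = f i - f j by ring] at h2
      linarith
  rw [Finset.card_range] at hcard
  have h3 : (T.card : ℝ) ≤ (⌊(v - u) / δ⌋₊ : ℝ) + 1 := by exact_mod_cast hcard
  have := Nat.floor_le (div_nonneg (sub_nonneg.2 huv) hδ.le)
  linarith

/-- A smooth approximation of the identity on `[0, 1]` that increases only on the intervals
`[p / q, p / q + ρ]` with `q ∈ Q` and `0 < p < q`. -/
noncomputable def fareyStaircase (Q : Finset ℕ) (ρ x : ℝ) : ℝ :=
  (Q.card : ℝ)⁻¹ * ∑ q ∈ Q, (q : ℝ)⁻¹ * ∑ p ∈ Finset.Ico 1 q, smoothTransition ((x - p / q) / ρ)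

variable {Q : Finset ℕ} {ρ : ℝ}

lemma contDiff_fareyStaircase {n : ℕ∞} : ContDiff ℝ n (fareyStaircase Q ρ) := by
  refine contDiff_const.mul (ContDiff.sum fun q _ => contDiff_const.mul (ContDiff.sum fun p _ => ?_))
  exact smoothTransition.contDiff.comp ((contDiff_id.sub contDiff_const).div_const _)

lemma monotone_fareyStaircase (hρ : 0 < ρ) : Monotone (fareyStaircase Q ρ) := by
  intro x y hxy
  unfold fareyStaircase
  gcongr with q _ p _
  exact smoothTransition.monotone (by gcongr)

lemma fareyStaircase_zero (hρ : 0 < ρ) : fareyStaircase Q ρ 0 = 0 := by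
  unfold fareyStaircase
  refine mul_eq_zero_of_right _ (Finset.sum_eq_zero fun q _ =>
    mul_eq_zero_of_right _ (Finset.sum_eq_zero fun p _ => smoothTransition.zero_of_nonpos ?_))
  refine div_nonpos_of_nonpos_of_nonneg ?_ hρ.le
  have : (0 : ℝ) ≤ p / q := by positivity
  linarith

lemma smoothTransition_eventuallyEq_const (hρ : 0 < ρ) {c x : ℝ} (hx : x ∉ Icc c (c + ρ)) :
    ∀ᶠ y in 𝓝 x, smoothTransition ((y - c) / ρ) = smoothTransition ((x - c) / ρ) := by
  rcases lt_or_ge x c with h | h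
  · filter_upwards [gt_mem_nhds h] with y hy
    rw [smoothTransition.zero_of_nonpos, smoothTransition.zero_of_nonpos] <;>
      exact div_nonpos_of_nonpos_of_nonneg (by linarith) hρ.le
  · have h' : c + ρ < x := by
      by_contra! h'
      exact hx ⟨h, h'⟩
    filter_upwards [lt_mem_nhds h'] with y hy
    rw [smoothTransition.one_of_one_le, smoothTransition.one_of_one_le] <;>
      rw [le_div_iff₀ hρ] <;> linarith

lemma deriv_fareyStaircase_eq_zero (hρ : 0 < ρ) {x : ℝ}
    (hx : ∀ q ∈ Q, ∀ p ∈ Finset.Ico 1 q, x ∉ Icc ((p : ℝ) / q) ((p : ℝ) / q + ρ)) :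
    deriv (fareyStaircase Q ρ) x = 0 := by
  have h : fareyStaircase Q ρ =ᶠ[𝓝 x] fun _ => fareyStaircase Q ρ x := by
    have h1 : ∀ᶠ y in 𝓝 x, ∀ q ∈ Q, ∀ p ∈ Finset.Ico 1 q,
        smoothTransition ((y - p / q) / ρ) = smoothTransition ((x - p / q) / ρ) :=
      (Q.eventually_all).2 fun q hq => (Finset.eventually_all _).2 fun p hp =>
        smoothTransition_eventuallyEq_const hρ (hx q hq p hp)
    filter_upwards [h1] with y hy
    unfold fareyStaircase
    congr 1
    exact Finset.sum_congr rfl fun q hq => by rw [Finset.sum_congr rfl fun p hp => hy q hq p hp]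
  rw [h.deriv_eq]
  simp

lemma abs_inv_mul_sum_smoothTransition_sub_le (hρ : 0 < ρ) {q : ℕ} (hq : 0 < q)
    (hρq : ρ * q ≤ 1) {x : ℝ} (hx : x ∈ Icc (0 : ℝ) 1) :
    |(q : ℝ)⁻¹ * (∑ p ∈ Finset.Ico 1 q, smoothTransition ((x - p / q) / ρ)) - x| ≤ 2 / q := by
  have hq' : (0 : ℝ) < q := by exact_mod_cast hq
  set S := ∑ p ∈ Finset.Ico 1 q, smoothTransition ((x - p / q) / ρ) with hS
  have hqx : 0 ≤ q * x := mul_nonneg hq'.le hx.1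
  have hup : S ≤ q * x + 1 := by
    have h1 : S ≤ ∑ p ∈ Finset.Ico 1 q, if p < ⌈q * x⌉₊ then (1 : ℝ) else 0 := by
      refine Finset.sum_le_sum fun p _ => ?_
      split_ifs with h
      · exact smoothTransition.le_one _
      · refine (smoothTransition.zero_of_nonpos ?_).le
        refine div_nonpos_of_nonpos_of_nonneg ?_ hρ.le
        rw [not_lt, Nat.ceil_le] at h
        rw [sub_nonpos, le_div_iff₀ hq']
        linarith
    rw [Finset.sum_ite, Finset.sum_const_zero, add_zero, Finset.sum_const, nsmul_one] at h1
    have h2 : ((Finset.Ico 1 q).filter (· < ⌈q * x⌉₊)).card ≤ ⌈q * x⌉₊ := by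
      refine (Finset.card_le_card (t := Finset.range ⌈q * x⌉₊) fun p hp => ?_).trans
        (Finset.card_range _).le
      exact Finset.mem_range.2 (Finset.mem_filter.1 hp).2
    have h3 : (((Finset.Ico 1 q).filter (· < ⌈q * x⌉₊)).card : ℝ) ≤ ⌈q * x⌉₊ := by exact_mod_cast h2
    linarith [(Nat.ceil_lt_add_one hqx).le]
  have hlow : q * x - 2 ≤ S := by
    have hfl : ⌊q * x⌋₊ ≤ q := by
      refine Nat.floor_le_of_le ?_
      nlinarith [hx.2]
    have h1 : ∑ p ∈ Finset.Ico 1 ⌊q * x⌋₊, (1 : ℝ) ≤ S := by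
      refine (Finset.sum_le_sum fun p hp => ?_).trans
        (Finset.sum_le_sum_of_subset_of_nonneg (Finset.Ico_subset_Ico_right hfl)
          fun p _ _ => smoothTransition.nonneg _)
      refine (smoothTransition.one_of_one_le ?_).ge
      have hp1 : p + 1 ≤ ⌊q * x⌋₊ := (Finset.mem_Ico.1 hp).2
      have hp2 : ((p + 1 : ℕ) : ℝ) ≤ q * x := (Nat.le_floor_iff hqx).1 hp1
      push_cast at hp2
      rw [le_div_iff₀ hρ, one_mul, le_sub_iff_add_le, ← le_sub_iff_add_le', div_le_iff₀ hq']
      linarith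
    rw [Finset.sum_const, nsmul_one, Nat.card_Ico] at h1
    have h2 : (⌊q * x⌋₊ : ℝ) - 1 ≤ ((⌊q * x⌋₊ - 1 : ℕ) : ℝ) := by
      have : ⌊q * x⌋₊ ≤ (⌊q * x⌋₊ - 1) + 1 := by omega
      have : (⌊q * x⌋₊ : ℝ) ≤ ((⌊q * x⌋₊ - 1 : ℕ) : ℝ) + 1 := by exact_mod_cast this
      linarith
    linarith [Nat.lt_floor_add_one (q * x)]
  have h : (q : ℝ)⁻¹ * S - x = (S - q * x) / q := by field_simp
  rw [h, abs_div, abs_of_pos hq']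
  gcongr
  rw [abs_le]
  constructor <;> linarith

lemma abs_fareyStaircase_sub_le (hρ : 0 < ρ) (hQ : Q.Nonempty) {L : ℝ} (hL : 0 < L)
    (hQL : ∀ q ∈ Q, L ≤ q) (hρQ : ∀ q ∈ Q, ρ * q ≤ 1) {x : ℝ} (hx : x ∈ Icc (0 : ℝ) 1) :
    |fareyStaircase Q ρ x - x| ≤ 2 / L := by
  have hP : (0 : ℝ) < Q.card := by exact_mod_cast hQ.card_pos
  have h : fareyStaircase Q ρ x - x = (Q.card : ℝ)⁻¹ * ∑ q ∈ Q,
      ((q : ℝ)⁻¹ * (∑ p ∈ Finset.Ico 1 q, smoothTransition ((x - p / q) / ρ)) - x) := by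
    rw [Finset.sum_sub_distrib, Finset.sum_const, nsmul_eq_mul, mul_sub, inv_mul_cancel_left₀ hP.ne']
    rfl
  rw [h, abs_mul, abs_of_pos (inv_pos.2 hP), inv_mul_le_iff₀ hP, ← nsmul_eq_mul, ← Finset.sum_const]
  refine (Finset.abs_sum_le_sum_abs _ _).trans (Finset.sum_le_sum fun q hq => ?_)
  have hq : L ≤ q ∧ ρ * q ≤ 1 := ⟨hQL q hq, hρQ q hq⟩
  have hq0 : (0 : ℝ) < q := hL.trans_le hq.1
  refine (abs_inv_mul_sum_smoothTransition_sub_le hρ (by exact_mod_cast hq0) hq.2 hx).trans ?_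
  gcongr
  exact hq.1

lemma smoothTransition_increment_eq_zero (hρ : 0 < ρ) {a b c : ℝ} (hab : a ≤ b)
    (hc : ¬ (a - ρ < c ∧ c < b)) :
    smoothTransition ((b - c) / ρ) - smoothTransition ((a - c) / ρ) = 0 := by
  rcases lt_or_ge (a - ρ) c with h | h
  · have h' : b ≤ c := by
      by_contra! h'
      exact hc ⟨h, h'⟩
    rw [smoothTransition.zero_of_nonpos, smoothTransition.zero_of_nonpos, sub_zero] <;>
      exact div_nonpos_of_nonpos_of_nonneg (by linarith) hρ.le
  · rw [smoothTransition.one_of_one_le, smoothTransition.one_of_one_le, sub_self] <;>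
      rw [le_div_iff₀ hρ] <;> linarith

lemma smoothTransition_sub_le_one (x y : ℝ) : smoothTransition x - smoothTransition y ≤ 1 := by
  linarith [smoothTransition.le_one x, smoothTransition.nonneg y]

lemma fareyStaircase_sub (a b : ℝ) : fareyStaircase Q ρ b - fareyStaircase Q ρ a =
    (Q.card : ℝ)⁻¹ * ∑ q ∈ Q, (q : ℝ)⁻¹ * ∑ p ∈ Finset.Ico 1 q,
      (smoothTransition ((b - p / q) / ρ) - smoothTransition ((a - p / q) / ρ)) := by
  simp only [fareyStaircase, Finset.sum_sub_distrib, mul_sub]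

lemma fareyStaircase_sub_le_mul (hρ : 0 < ρ) (hQ : Q.Nonempty) {L : ℝ} (hL : 0 < L)
    (hQL : ∀ q ∈ Q, L ≤ q) {a b : ℝ} (hab : a ≤ b) :
    fareyStaircase Q ρ b - fareyStaircase Q ρ a ≤ b - a + ρ + 1 / L := by
  have hP : (0 : ℝ) < Q.card := by exact_mod_cast hQ.card_pos
  rw [fareyStaircase_sub, inv_mul_le_iff₀ hP, ← nsmul_eq_mul, ← Finset.sum_const]
  refine Finset.sum_le_sum fun q hq => ?_
  have hq0 : (0 : ℝ) < q := hL.trans_le (hQL q hq)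
  set T := (Finset.Ico 1 q).filter fun p : ℕ => a - ρ < (p : ℝ) / q ∧ (p : ℝ) / q < b
  have h1 : ∑ p ∈ Finset.Ico 1 q,
      (smoothTransition ((b - p / q) / ρ) - smoothTransition ((a - p / q) / ρ)) ≤ T.card := by
    rw [← nsmul_one T.card, ← Finset.sum_const, Finset.sum_filter]
    refine Finset.sum_le_sum fun p _ => ?_
    split_ifs with h
    · exact smoothTransition_sub_le_one _ _
    · exact (smoothTransition_increment_eq_zero hρ hab h).le
  have h2 : (T.card : ℝ) ≤ (b - (a - ρ)) / (1 / q) + 1 := by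
    refine card_le_of_separated T (fun p : ℕ => (p : ℝ) / q) (by positivity) (by linarith)
      (fun p hp => (Finset.mem_filter.1 hp).2) fun p _ p' _ hne => ?_
    rw [← sub_div, abs_div, abs_of_pos hq0]
    gcongr
    have : (1 : ℤ) ≤ |(p : ℤ) - p'| := Int.one_le_abs (sub_ne_zero.2 (by exact_mod_cast hne))
    exact_mod_cast this
  rw [inv_mul_le_iff₀ hq0]
  have h3 : 1 ≤ q * (1 / L) := by
    rw [mul_one_div, le_div_iff₀ hL, one_mul]
    exact hQL q hq
  have h4 : (b - (a - ρ)) / (1 / q) = q * (b - a + ρ) := by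
    field_simp
    ring
  linarith

lemma one_div_sq_le_abs_div_sub_div {N q q' p p' : ℕ} (hq : q.Prime) (hq' : q'.Prime)
    (hqN : q ≤ N) (hqN' : q' ≤ N) (hp : p ∈ Finset.Ico 1 q) (hp' : p' ∈ Finset.Ico 1 q')
    (hne : (q, p) ≠ (q', p')) : 1 / (N : ℝ) ^ 2 ≤ |(p : ℝ) / q - (p' : ℝ) / q'| := by
  rw [Finset.mem_Ico] at hp hp'
  have hq0 : (0 : ℝ) < q := by exact_mod_cast hq.pos
  have hq0' : (0 : ℝ) < q' := by exact_mod_cast hq'.pos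
  have hcross : (p : ℤ) * q' - q * p' ≠ 0 := by
    intro h
    have h : p * q' = q * p' := by exact_mod_cast sub_eq_zero.1 h
    have hdvd : q ∣ p * q' := ⟨p', h⟩
    rcases hq.dvd_mul.1 hdvd with h1 | h1
    · exact absurd (Nat.le_of_dvd (by omega) h1) (by omega)
    · have h2 : q = q' := (Nat.prime_dvd_prime_iff_eq hq hq').1 h1
      subst h2
      rw [mul_comm] at h
      exact hne (by rw [Nat.eq_of_mul_eq_mul_left hq.pos h])
  have habs : (1 : ℝ) ≤ |(p : ℝ) * q' - q * p'| := by exact_mod_cast Int.one_le_abs hcross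
  rw [div_sub_div _ _ hq0.ne' hq0'.ne', abs_div, abs_of_pos (mul_pos hq0 hq0')]
  have hqN1 : (q : ℝ) ≤ N := by exact_mod_cast hqN
  have hqN1' : (q' : ℝ) ≤ N := by exact_mod_cast hqN'
  gcongr
  rw [sq]
  gcongr

lemma fareyStaircase_sub_le_of_prime (hρ : 0 < ρ) (hQ : Q.Nonempty) {L : ℝ} (hL : 0 < L) {N : ℕ}
    (hQL : ∀ q ∈ Q, L ≤ q) (hQN : ∀ q ∈ Q, q ≤ N) (hQp : ∀ q ∈ Q, q.Prime) {a b m : ℝ}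
    (hab : a ≤ b) (hm0 : 0 ≤ m)
    (hm : ∀ c, smoothTransition ((b - c) / ρ) - smoothTransition ((a - c) / ρ) ≤ m) :
    fareyStaircase Q ρ b - fareyStaircase Q ρ a
      ≤ ((b - a + ρ) * (N : ℝ) ^ 2 + 1) * m / (Q.card * L) := by
  have hP : (0 : ℝ) < Q.card := by exact_mod_cast hQ.card_pos
  set T := (Q.sigma fun q => Finset.Ico 1 q).filter
    fun i : (_ : ℕ) × ℕ => a - ρ < (i.2 : ℝ) / i.1 ∧ (i.2 : ℝ) / i.1 < b with hT
  have hN : (0 : ℝ) < N := by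
    obtain ⟨q, hq⟩ := hQ
    exact_mod_cast (hQp q hq).pos.trans_le (hQN q hq)
  have hTcard : (T.card : ℝ) ≤ (b - (a - ρ)) / (1 / (N : ℝ) ^ 2) + 1 := by
    refine card_le_of_separated T (fun i => (i.2 : ℝ) / i.1) (by positivity) (by linarith)
      (fun i hi => (Finset.mem_filter.1 hi).2) ?_
    rintro ⟨q, p⟩ hi ⟨q', p'⟩ hi' hne
    have hi := Finset.mem_sigma.1 (Finset.mem_filter.1 hi).1
    have hi' := Finset.mem_sigma.1 (Finset.mem_filter.1 hi').1
    refine one_div_sq_le_abs_div_sub_div (hQp q hi.1) (hQp q' hi'.1) (hQN q hi.1) (hQN q' hi'.1)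
      hi.2 hi'.2 fun h => hne ?_
    obtain ⟨rfl, rfl⟩ := Prod.mk.inj h
    rfl
  have hsum : ∑ q ∈ Q, (q : ℝ)⁻¹ * ∑ p ∈ Finset.Ico 1 q,
      (smoothTransition ((b - p / q) / ρ) - smoothTransition ((a - p / q) / ρ))
        ≤ T.card * (L⁻¹ * m) := by
    simp_rw [Finset.mul_sum]
    rw [Finset.sum_sigma', ← nsmul_eq_mul, ← Finset.sum_const, Finset.sum_filter]
    refine Finset.sum_le_sum fun i hi => ?_
    have hqL := hQL i.1 (Finset.mem_sigma.1 hi).1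
    split_ifs with h
    · refine (mul_le_mul_of_nonneg_left (hm _) (by positivity)).trans ?_
      gcongr
    · rw [smoothTransition_increment_eq_zero hρ hab h, mul_zero]
  rw [fareyStaircase_sub, inv_mul_le_iff₀ hP]
  refine hsum.trans ?_
  have h1 : Q.card * (((b - a + ρ) * (N : ℝ) ^ 2 + 1) * m / (Q.card * L))
      = ((b - (a - ρ)) / (1 / (N : ℝ) ^ 2) + 1) * (L⁻¹ * m) := by
    field_simp
    ring
  rw [h1]
  gcongr

/-- Frostman-type estimate for the staircase: on long intervals it is comparable to the identity,
on short ones it is controlled by the power `s` of the length. -/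
lemma fareyStaircase_sub_le_add {A : ℝ} (hA : 1 ≤ A)
    (hAΨ : ∀ x y, x ≤ y → smoothTransition y - smoothTransition x ≤ A * (y - x))
    (hρ : 0 < ρ) (hQ : Q.Nonempty) {L : ℝ} (hL : 0 < L) {N : ℕ}
    (hQL : ∀ q ∈ Q, L ≤ q) (hQN : ∀ q ∈ Q, q ≤ N) (hQp : ∀ q ∈ Q, q.Prime)
    (hρL : ρ ≤ 1 / L) (hρN : ρ * (N : ℝ) ^ 2 ≤ 1) {s η : ℝ} (hs0 : 0 < s) (hs1 : s < 1)
    (hη : (N : ℝ) ^ 2 * L ^ (s - 1) + 2 * A * ρ ^ (-s) ≤ η * (Q.card * L)) {a b : ℝ}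
    (hab : a < b) :
    fareyStaircase Q ρ b - fareyStaircase Q ρ a ≤ 3 * (b - a) + η * (b - a) ^ s := by
  have hP : (0 : ℝ) < Q.card := by exact_mod_cast hQ.card_pos
  have hr : 0 < b - a := sub_pos.2 hab
  have hη0 : 0 ≤ η := by
    have : 0 ≤ η * (Q.card * L) := le_trans (by positivity) hη
    exact nonneg_of_mul_nonneg_left this (by positivity)
  rcases le_or_gt (1 / L) (b - a) with hlong | hshort
  · have := fareyStaircase_sub_le_mul hρ hQ hL hQL hab.le
    have h0 : 0 ≤ η * (b - a) ^ s := by positivity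
    linarith
  set r := b - a with hrdef
  set m := min 1 (A * (r / ρ)) with hmdef
  have hm0 : 0 ≤ m := le_min zero_le_one (by positivity)
  have hm : ∀ c, smoothTransition ((b - c) / ρ) - smoothTransition ((a - c) / ρ) ≤ m := by
    refine fun c => le_min (smoothTransition_sub_le_one _ _) ?_
    refine (hAΨ _ _ (by gcongr)).trans_eq ?_
    rw [hrdef]
    ring
  have hms : m ≤ A * (r / ρ) ^ s := by
    rcases le_total 1 (r / ρ) with h | h
    · refine (min_le_left _ _).trans ?_
      have := Real.one_le_rpow h hs0.le
      nlinarith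
    · refine (min_le_right _ _).trans ?_
      gcongr
      simpa using Real.rpow_le_rpow_of_exponent_ge (by positivity) h hs1.le
  have hrs : r ≤ L ^ (s - 1) * r ^ s := by
    have h1 : r ^ (1 - s) ≤ (1 / L) ^ (1 - s) :=
      Real.rpow_le_rpow hr.le hshort.le (by linarith)
    rw [one_div, Real.inv_rpow hL.le, ← Real.rpow_neg hL.le, neg_sub] at h1
    calc r = r ^ (1 - s) * r ^ s := by rw [← Real.rpow_add hr]; simp
      _ ≤ _ := by gcongr
  refine (fareyStaircase_sub_le_of_prime hρ hQ hL hQL hQN hQp hab.le hm0 hm).trans ?_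
  have hmain : ((r + ρ) * (N : ℝ) ^ 2 + 1) * m ≤ η * r ^ s * (Q.card * L) := by
    have hm1 : m ≤ 1 := min_le_left _ _
    calc ((r + ρ) * (N : ℝ) ^ 2 + 1) * m
        = r * (N : ℝ) ^ 2 * m + (ρ * (N : ℝ) ^ 2 + 1) * m := by ring
      _ ≤ r * (N : ℝ) ^ 2 * 1 + (1 + 1) * m := by gcongr
      _ ≤ L ^ (s - 1) * r ^ s * (N : ℝ) ^ 2 * 1 + (1 + 1) * (A * (r / ρ) ^ s) := by gcongr
      _ = ((N : ℝ) ^ 2 * L ^ (s - 1) + 2 * A * ρ ^ (-s)) * r ^ s := by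
          rw [Real.div_rpow hr.le hρ.le, Real.rpow_neg hρ.le]
          field_simp
          ring
      _ ≤ η * (Q.card * L) * r ^ s := by gcongr
      _ = _ := by ring
  have := (div_le_iff₀ (mul_pos hP hL)).2 hmain
  have h3 : 0 ≤ 3 * r := by positivity
  linarith

end Staircase

section Primes

lemma eventually_rpow_le_primeCounting {θ : ℝ} (hθ : θ < 1) :
    ∀ᶠ N : ℕ in atTop, 2 * (N : ℝ) ^ θ ≤ Nat.primeCounting N := by
  have h1 : ∀ᶠ x : ℝ in atTop, ‖Real.log x‖ ≤ (1 / 10) * ‖x ^ (1 - θ)‖ :=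
    (isLittleO_log_rpow_atTop (sub_pos.2 hθ)).bound (by norm_num)
  have h2 : ∀ᶠ x : ℝ in atTop, ‖Real.log x‖ ≤ (1 / 10) * ‖x ^ (1 : ℝ)‖ :=
    (isLittleO_log_rpow_atTop one_pos).bound (by norm_num)
  filter_upwards [tendsto_natCast_atTop_atTop.eventually h1,
    tendsto_natCast_atTop_atTop.eventually h2, eventually_ge_atTop 10] with N hN1 hN2 hN
  have hN' : (10 : ℝ) ≤ N := by exact_mod_cast hN
  have hlog : 0 < Real.log N := Real.log_pos (by linarith)
  rw [Real.norm_of_nonneg hlog.le, Real.norm_of_nonneg (by positivity)] at hN1 hN2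
  rw [Real.rpow_one] at hN2
  refine le_trans ?_ (Chebyshev.pi_ge N)
  rw [le_div_iff₀ hlog]
  have h3 : (N : ℝ) ^ θ * (N : ℝ) ^ (1 - θ) = N := by
    rw [← Real.rpow_add (by linarith)]
    simp
  have h4 : (N : ℝ) ^ θ * Real.log N ≤ (N : ℝ) ^ θ * (1 / 10 * (N : ℝ) ^ (1 - θ)) := by gcongr
  have h5 : Real.log (N + 1) ≤ Real.log 2 + Real.log N := by
    rw [← Real.log_mul (by norm_num) (by linarith)]
    exact Real.log_le_log (by linarith) (by linarith)
  have := Real.log_two_gt_d9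
  have := Real.log_two_lt_d9
  nlinarith

lemma eventually_rpow_le_card_primes {θ : ℝ} (hθ : θ < 1) :
    ∀ᶠ N : ℕ in atTop, (N : ℝ) ^ θ ≤
      ((Finset.Ioc ⌊(N : ℝ) ^ θ⌋₊ N).filter Nat.Prime).card := by
  filter_upwards [eventually_rpow_le_primeCounting hθ] with N hN
  have h1 : Nat.primeCounting N ≤
      ((Finset.Ioc ⌊(N : ℝ) ^ θ⌋₊ N).filter Nat.Prime).card + ⌊(N : ℝ) ^ θ⌋₊ := by
    rw [← Nat.primesLE_card_eq_primeCounting]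
    refine (Finset.card_le_card (t := ((Finset.Ioc ⌊(N : ℝ) ^ θ⌋₊ N).filter Nat.Prime) ∪
      Finset.Ioc 0 ⌊(N : ℝ) ^ θ⌋₊) fun p hp => ?_).trans ((Finset.card_union_le _ _).trans ?_)
    · have hp := Nat.mem_primesLE.1 hp
      rcases le_or_gt p ⌊(N : ℝ) ^ θ⌋₊ with h | h
      · exact Finset.mem_union_right _ (Finset.mem_Ioc.2 ⟨hp.2.pos, h⟩)
      · exact Finset.mem_union_left _ (Finset.mem_filter.2 ⟨Finset.mem_Ioc.2 ⟨h, hp.1⟩, hp.2⟩)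
    · simp
  have h2 : (Nat.primeCounting N : ℝ) ≤
      ((Finset.Ioc ⌊(N : ℝ) ^ θ⌋₊ N).filter Nat.Prime).card + (⌊(N : ℝ) ^ θ⌋₊ : ℝ) := by
    exact_mod_cast h1
  have := Nat.floor_le (by positivity : 0 ≤ (N : ℝ) ^ θ)
  linarith

lemma eventually_mul_rpow_le (c : ℝ) {β γ : ℝ} (h : β < γ) :
    ∀ᶠ N : ℕ in atTop, c * (N : ℝ) ^ β ≤ (N : ℝ) ^ γ := by
  have h1 : Tendsto (fun N : ℕ => c * (N : ℝ) ^ (-(γ - β))) atTop (𝓝 0) := by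
    simpa using ((tendsto_rpow_neg_atTop (sub_pos.2 h)).comp
      tendsto_natCast_atTop_atTop).const_mul c
  filter_upwards [h1.eventually (gt_mem_nhds one_pos), eventually_ge_atTop 1] with N hN hN1
  have hN0 : (0 : ℝ) < N := by exact_mod_cast hN1
  calc c * (N : ℝ) ^ β = c * (N : ℝ) ^ (-(γ - β)) * (N : ℝ) ^ γ := by
        rw [mul_assoc, ← Real.rpow_add hN0]
        congr 2
        ring
    _ ≤ 1 * (N : ℝ) ^ γ := by gcongr
    _ = _ := one_mul _

end Primes

section LowerBound

open Real (smoothTransition)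
open intervalIntegral MeasureTheory

/-- Oscillating densities that are weakly close to `1` on `[0, 1]`, satisfy a Frostman estimate of
exponent `s < 2 / α`, and live on points with a rational approximation of order `α`. -/
lemma exists_oscillating_density {α s : ℝ} (hα : 2 < α) (hs0 : 0 < s) (hs : s < 2 / α)
    {η : ℝ} (hη : 0 < η) (M : ℕ) :
    ∃ (F : ℝ → ℝ) (Z : Set ℝ), ContDiff ℝ 1 F ∧ (∀ x, 0 ≤ F x) ∧ IsClosed Z ∧
      (∀ x ∉ Z, F x = 0) ∧
      (∀ x ∈ Z, ∃ p q : ℕ, M < q ∧ |x - (p : ℝ) / q| < (q : ℝ) ^ (-α)) ∧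
      (∀ x ∈ Icc (0 : ℝ) 1, |(∫ y in (0 : ℝ)..x, F y) - x| ≤ η) ∧
      ∀ a b : ℝ, a < b → ∫ y in a..b, F y ≤ 3 * (b - a) + η * (b - a) ^ s := by
  have hα0 : 0 < α := by linarith
  have hs1 : s < 1 := hs.trans ((div_lt_one hα0).2 hα)
  have hαs : α * s < 2 := by
    rw [lt_div_iff₀ hα0] at hs
    linarith
  obtain ⟨A, hA, hAΨ⟩ := exists_smoothTransition_sub_le
  obtain ⟨θ, hθ, hθ1⟩ : ∃ θ, max (max (α * s / 2) (2 / (3 - s))) 0 < θ ∧ θ < 1 := by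
    refine exists_between (max_lt (max_lt ?_ ?_) one_pos)
    · linarith
    · rw [div_lt_one] <;> linarith
  obtain ⟨hθ', hθ0⟩ := max_lt_iff.1 hθ
  obtain ⟨hθa, hθb⟩ := max_lt_iff.1 hθ'
  have hθb : 2 + θ * (s - 1) < θ + θ := by
    rw [div_lt_iff₀ (by linarith)] at hθb
    linarith
  have hθa : α * s < θ + θ := by linarith
  have hbig : ∀ c : ℝ, ∀ᶠ N : ℕ in atTop, c ≤ (N : ℝ) ^ θ := fun c => by
    simpa using eventually_mul_rpow_le c hθ0
  obtain ⟨N, hcard, h1, h2, hM, hη2, hN1⟩ := ((eventually_rpow_le_card_primes hθ1).and <|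
    (eventually_mul_rpow_le (2 / η) hθb).and <|
    (eventually_mul_rpow_le (2 / η * (2 * A * 2 ^ s)) hθa).and <|
    (hbig M).and <| (hbig (2 / η)).and (eventually_ge_atTop 1)).exists
  have hN0 : (0 : ℝ) < N := by exact_mod_cast hN1
  have hN1' : (1 : ℝ) ≤ N := by exact_mod_cast hN1
  set L : ℝ := (N : ℝ) ^ θ with hLdef
  set Q := (Finset.Ioc ⌊L⌋₊ N).filter Nat.Prime with hQdef
  set ρ : ℝ := (N : ℝ) ^ (-α) / 2 with hρdef
  have hL : 0 < L := by positivity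
  have hLN : L ≤ N := by simpa using Real.rpow_le_rpow_of_exponent_le hN1' hθ1.le
  have hρ : 0 < ρ := by positivity
  have hQ : Q.Nonempty := Finset.card_pos.1 (by exact_mod_cast hL.trans_le hcard)
  have hQL : ∀ q ∈ Q, L < q := fun q hq =>
    (Nat.floor_lt hL.le).1 (Finset.mem_Ioc.1 (Finset.mem_filter.1 hq).1).1
  have hQN : ∀ q ∈ Q, q ≤ N := fun q hq => (Finset.mem_Ioc.1 (Finset.mem_filter.1 hq).1).2
  have hQp : ∀ q ∈ Q, q.Prime := fun q hq => (Finset.mem_filter.1 hq).2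
  have hρN : ρ * (N : ℝ) ^ 2 ≤ 1 := by
    have h3 : (N : ℝ) ^ (-α) * (N : ℝ) ^ (2 : ℝ) ≤ 1 := by
      rw [← Real.rpow_add hN0]
      exact Real.rpow_le_one_of_one_le_of_nonpos hN1' (by linarith)
    rw [Real.rpow_two] at h3
    have h4 : 0 ≤ (N : ℝ) ^ (-α) * (N : ℝ) ^ 2 := by positivity
    rw [hρdef]
    linarith
  have hρN' : ρ * N ≤ 1 := by
    refine le_trans ?_ hρN
    gcongr
    nlinarith
  have hρL : ρ ≤ 1 / L := by
    rw [le_div_iff₀ hL]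
    exact le_trans (by gcongr) hρN'
  have hρQ : ∀ q ∈ Q, ρ * q ≤ 1 := fun q hq => by
    have : (q : ℝ) ≤ N := by exact_mod_cast hQN q hq
    exact le_trans (by gcongr) hρN'
  have hpar : (N : ℝ) ^ 2 * L ^ (s - 1) + 2 * A * ρ ^ (-s) ≤ η * (Q.card * L) := by
    have e1 : (N : ℝ) ^ 2 * L ^ (s - 1) = (N : ℝ) ^ (2 + θ * (s - 1)) := by
      rw [hLdef, ← Real.rpow_mul hN0.le, Real.rpow_add hN0, Real.rpow_two]
    have e2 : ρ ^ (-s) = 2 ^ s * (N : ℝ) ^ (α * s) := by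
      rw [hρdef, Real.div_rpow (by positivity) (by norm_num), ← Real.rpow_mul hN0.le,
        Real.rpow_neg (by norm_num : (0 : ℝ) ≤ 2), neg_mul_neg]
      field_simp
    have e3 : (N : ℝ) ^ (θ + θ) = L * L := Real.rpow_add hN0 _ _
    rw [e3] at h1 h2
    rw [e1, e2]
    have f1 : (N : ℝ) ^ (2 + θ * (s - 1)) ≤ η / 2 * (L * L) := by
      calc _ = η / 2 * (2 / η * (N : ℝ) ^ (2 + θ * (s - 1))) := by field_simp
        _ ≤ _ := by gcongr
    have f2 : 2 * A * (2 ^ s * (N : ℝ) ^ (α * s)) ≤ η / 2 * (L * L) := by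
      calc _ = η / 2 * (2 / η * (2 * A * 2 ^ s) * (N : ℝ) ^ (α * s)) := by field_simp
        _ ≤ _ := by gcongr
    have f3 : η * (L * L) ≤ η * (Q.card * L) := by gcongr
    linarith
  have hcd : ContDiff ℝ 2 (fareyStaircase Q ρ) := contDiff_fareyStaircase (n := 2)
  have hF : ContDiff ℝ 1 (deriv (fareyStaircase Q ρ)) := by
    refine ContDiff.deriv' (n := 1) ?_
    rwa [one_add_one_eq_two]
  have hint : ∀ a b : ℝ, ∫ y in a..b, deriv (fareyStaircase Q ρ) y
      = fareyStaircase Q ρ b - fareyStaircase Q ρ a := fun a b =>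
    integral_deriv_eq_sub (fun x _ => hcd.differentiable two_ne_zero x)
      (hF.continuous.intervalIntegrable a b)
  refine ⟨deriv (fareyStaircase Q ρ),
    ⋃ q ∈ Q, ⋃ p ∈ Finset.Ico 1 q, Icc ((p : ℝ) / q) ((p : ℝ) / q + ρ), hF,
    fun x => (monotone_fareyStaircase hρ).deriv_nonneg, ?_, ?_, ?_, ?_, ?_⟩
  · exact isClosed_biUnion_finset fun q _ => isClosed_biUnion_finset fun p _ => isClosed_Icc
  · intro x hx
    simp only [mem_iUnion, not_exists] at hx
    exact deriv_fareyStaircase_eq_zero hρ fun q hq p hp => hx q hq p hp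
  · intro x hx
    simp only [mem_iUnion] at hx
    obtain ⟨q, hq, p, hp, hx⟩ := hx
    refine ⟨p, q, by exact_mod_cast hM.trans_lt (hQL q hq), ?_⟩
    have hq0 : (0 : ℝ) < q := hL.trans (hQL q hq)
    have hqα : (N : ℝ) ^ (-α) ≤ (q : ℝ) ^ (-α) :=
      Real.rpow_le_rpow_of_nonpos hq0 (by exact_mod_cast hQN q hq) (by linarith)
    have h3 : (0 : ℝ) < (N : ℝ) ^ (-α) := by positivity
    rw [abs_of_nonneg (by linarith [hx.1])]
    have := hx.2
    rw [hρdef] at this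
    linarith
  · intro x hx
    rw [hint, fareyStaircase_zero hρ, sub_zero]
    refine (abs_fareyStaircase_sub_le hρ hQ hL (fun q hq => (hQL q hq).le) hρQ hx).trans ?_
    rw [div_le_iff₀ hL]
    rw [div_le_iff₀ hη] at hη2
    linarith
  · intro a b hab
    rw [hint]
    exact fareyStaircase_sub_le_add hA hAΨ hρ hQ hL (fun q hq => (hQL q hq).le) hQN hQp hρL hρN
      hs0 hs1 hpar hab

/-- `g` is a density on `[0, 1]`, carried by the compact set `K`, whose mass exceeds `1 / 2` and
which satisfies a Frostman estimate of exponent `s` with a constant below `2`. -/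
structure FrostmanDensity (s : ℝ) (g : ℝ → ℝ) (K : Set ℝ) : Prop where
  contDiff : ContDiff ℝ 1 g
  nonneg : ∀ x, 0 ≤ g x
  isCompact : IsCompact K
  subset : K ⊆ Icc 0 1
  eq_zero : ∀ x ∈ Icc (0 : ℝ) 1, x ∉ K → g x = 0
  mass : 1 / 2 < ∫ x in (0 : ℝ)..1, g x
  frostman : ∃ C < 2, ∀ a b, 0 ≤ a → a < b → b ≤ 1 → ∫ x in a..b, g x ≤ C * (b - a) ^ s

lemma frostmanDensity_one {s : ℝ} (hs1 : s < 1) :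
    FrostmanDensity s (fun _ => 1) (Icc 0 1) where
  contDiff := contDiff_const
  nonneg _ := zero_le_one
  isCompact := isCompact_Icc
  subset := Subset.rfl
  eq_zero _ hx hx' := absurd hx hx'
  mass := by norm_num
  frostman := by
    refine ⟨1, by norm_num, fun a b ha hab hb => ?_⟩
    have := Real.rpow_le_rpow_of_exponent_ge (sub_pos.2 hab) (by linarith) hs1.le
    simpa using this

lemma FrostmanDensity.exists_refinement {α s : ℝ} (hα : 2 < α) (hs0 : 0 < s) (hs : s < 2 / α)
    {g : ℝ → ℝ} {K : Set ℝ} (h : FrostmanDensity s g K) (M : ℕ) :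
    ∃ (g' : ℝ → ℝ) (K' : Set ℝ), FrostmanDensity s g' K' ∧ K' ⊆ K ∧
      ∀ x ∈ K', ∃ p q : ℕ, M < q ∧ |x - (p : ℝ) / q| < (q : ℝ) ^ (-α) := by
  have hs1 : s < 1 := hs.trans ((div_lt_one (by linarith)).2 hα)
  obtain ⟨D, hD0, hD⟩ := abs_integral_mul_sub_integral_le h.contDiff
  obtain ⟨B, hB⟩ := (isCompact_Icc (a := (0 : ℝ)) (b := 1)).exists_bound_of_continuousOn
    h.contDiff.continuous.continuousOn
  have hB0 : 0 ≤ B := (norm_nonneg _).trans (hB 0 (by simp))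
  obtain ⟨C, hC2, hC⟩ := h.frostman
  set C₁ := max C 1
  have hC₁ : C₁ < 2 := max_lt hC2 one_lt_two
  have hC₁' : 1 ≤ C₁ := le_max_right _ _
  set σ := (∫ x in (0 : ℝ)..1, g x) - 1 / 2 with hσ
  have hσ0 : 0 < σ := sub_pos.2 h.mass
  set r₀ : ℝ := (1 / (6 * (B + 1))) ^ (1 / (1 - s)) with hr₀
  have hr₀0 : 0 < r₀ := by positivity
  obtain ⟨η, hη0, hη⟩ : ∃ η : ℝ, 0 < η ∧
      η < min (1 / (2 * (B + 1))) (min ((2 - C₁) / 2 * r₀ ^ s / D) (σ / D)) := by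
    refine exists_between (lt_min (by positivity) (lt_min ?_ (by positivity)))
    have : 0 < 2 - C₁ := by linarith
    positivity
  obtain ⟨hη1, hη⟩ := lt_min_iff.1 hη
  obtain ⟨hη2, hη3⟩ := lt_min_iff.1 hη
  rw [lt_div_iff₀ (by positivity)] at hη1
  rw [lt_div_iff₀ hD0] at hη2 hη3
  obtain ⟨F, Z, hF, hF0, hZ, hFZ, hZq, hFx, hFI⟩ := exists_oscillating_density hα hs0 hs hη0 M
  have hweak := hD F η hF.continuous hFx
  refine ⟨fun x => g x * F x, K ∩ Z, ⟨h.contDiff.mul hF, fun x => mul_nonneg (h.nonneg x) (hF0 x),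
    h.isCompact.inter_right hZ, inter_subset_left.trans h.subset, ?_, ?_, ?_⟩, inter_subset_left,
    fun x hx => hZq x hx.2⟩
  · intro x hx hxK
    by_cases hxK' : x ∈ K
    · rw [hFZ x fun hxZ => hxK ⟨hxK', hxZ⟩, mul_zero]
    · rw [h.eq_zero x hx hxK', zero_mul]
  · have := (abs_le.1 (hweak 0 1 le_rfl zero_le_one le_rfl)).1
    linarith
  · refine ⟨(C₁ + 2) / 2, by linarith, fun a b ha hab hb => ?_⟩
    have hr : 0 < b - a := sub_pos.2 hab
    rcases le_or_gt r₀ (b - a) with hlong | hshort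
    · have h1 := (abs_le.1 (hweak a b ha hab.le hb)).2
      have h2 := hC a b ha hab hb
      have h3 : r₀ ^ s ≤ (b - a) ^ s := by gcongr
      have h4 : C * (b - a) ^ s ≤ C₁ * (b - a) ^ s := by
        gcongr
        exact le_max_left _ _
      have h5 : (2 - C₁) / 2 * r₀ ^ s ≤ (2 - C₁) / 2 * (b - a) ^ s := by
        gcongr
      linarith
    · have h1 : ∫ x in a..b, g x * F x ≤ ∫ x in a..b, B * F x := by
        refine integral_mono_on hab.le
          ((h.contDiff.continuous.mul hF.continuous).intervalIntegrable _ _)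
          ((continuous_const.mul hF.continuous).intervalIntegrable _ _) fun x hx => ?_
        have hx' : x ∈ Icc (0 : ℝ) 1 := ⟨ha.trans hx.1, hx.2.trans hb⟩
        exact mul_le_mul_of_nonneg_right ((le_abs_self _).trans (hB x hx')) (hF0 x)
      rw [intervalIntegral.integral_const_mul] at h1
      have h2 : (b - a) ^ (1 - s) ≤ 1 / (6 * (B + 1)) := by
        have : (b - a) ^ (1 - s) ≤ r₀ ^ (1 - s) :=
          Real.rpow_le_rpow hr.le hshort.le (by linarith)
        rwa [hr₀, ← Real.rpow_mul (by positivity), one_div_mul_cancel (by linarith),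
          Real.rpow_one] at this
      rw [le_div_iff₀ (by positivity)] at h2
      have h3 : b - a = (b - a) ^ (1 - s) * (b - a) ^ s := by
        rw [← Real.rpow_add hr]
        simp
      have h4 : 0 < (b - a) ^ (1 - s) := by positivity
      calc ∫ x in a..b, g x * F x ≤ B * ∫ x in a..b, F x := h1
        _ ≤ B * (3 * (b - a) + η * (b - a) ^ s) := by
          gcongr
          exact hFI a b hab
        _ = (3 * B * (b - a) ^ (1 - s) + B * η) * (b - a) ^ s := by
          rw [mul_add, add_mul]
          congr 1
          · conv_lhs => rw [h3]
            ring
          · ring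
        _ ≤ (C₁ + 2) / 2 * (b - a) ^ s := by
          gcongr
          nlinarith

lemma setLIntegral_ofReal_Icc {g : ℝ → ℝ} (hg : Continuous g) (hg0 : ∀ x, 0 ≤ g x) {a b : ℝ}
    (hab : a ≤ b) :
    ∫⁻ x in Icc a b, ENNReal.ofReal (g x) = ENNReal.ofReal (∫ x in a..b, g x) := by
  rw [integral_of_le hab, ← integral_Icc_eq_integral_Ioc,
    ofReal_integral_eq_lintegral_ofReal (hg.integrableOn_Icc) (Eventually.of_forall hg0)]

lemma FrostmanDensity.exists_measure {s : ℝ} (hs0 : 0 < s) {g : ℝ → ℝ} {K : Set ℝ}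
    (h : FrostmanDensity s g K) :
    ∃ μ : Measure ℝ, μ Kᶜ = 0 ∧ ENNReal.ofReal (1 / 2) ≤ μ univ ∧
      ∀ a b, a < b → μ (Ioo a b) ≤ 2 * ENNReal.ofReal ((b - a) ^ s) := by
  have hgc := h.contDiff.continuous
  refine ⟨(volume.restrict (Icc 0 1)).withDensity fun x => ENNReal.ofReal (g x), ?_, ?_, ?_⟩
  · have hKm : MeasurableSet Kᶜ := h.isCompact.isClosed.measurableSet.compl
    rw [withDensity_apply _ hKm, Measure.restrict_restrict hKm,
      setLIntegral_congr_fun (g := fun _ => 0) (hKm.inter measurableSet_Icc) fun x hx => by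
        simp [h.eq_zero x hx.2 hx.1]]
    simp
  · rw [withDensity_apply _ MeasurableSet.univ, Measure.restrict_univ,
      setLIntegral_ofReal_Icc hgc h.nonneg zero_le_one]
    exact ENNReal.ofReal_le_ofReal h.mass.le
  · intro a b hab
    rw [withDensity_apply _ measurableSet_Ioo, Measure.restrict_restrict measurableSet_Ioo]
    refine (lintegral_mono_set (t := Icc (max a 0) (min b 1)) fun x hx =>
      ⟨max_le hx.1.1.le hx.2.1, le_min hx.1.2.le hx.2.2⟩).trans ?_
    rcases lt_or_ge (max a 0) (min b 1) with hlt | hge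
    · rw [setLIntegral_ofReal_Icc hgc h.nonneg hlt.le,
        ← ENNReal.ofReal_ofNat, ← ENNReal.ofReal_mul (by norm_num)]
      obtain ⟨C, hC2, hC⟩ := h.frostman
      refine ENNReal.ofReal_le_ofReal ((hC _ _ (le_max_right _ _) hlt (min_le_right _ _)).trans ?_)
      have hle : min b 1 - max a 0 ≤ b - a := sub_le_sub (min_le_left _ _) (le_max_left _ _)
      have h0 : 0 ≤ min b 1 - max a 0 := by linarith
      gcongr
    · rw [setLIntegral_measure_zero _ _ (by simpa using hge)]
      exact zero_le

lemma hausdorffMeasure_JSet_ne_zero {α s : ℝ} (hα : 2 < α) (hs0 : 0 < s) (hs : s < 2 / α) :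
    Measure.hausdorffMeasure s (JSet α) ≠ 0 := by
  have hs1 : s < 1 := hs.trans ((div_lt_one (by linarith)).2 hα)
  have hstep : ∀ (c : {c : (ℝ → ℝ) × Set ℝ // FrostmanDensity s c.1 c.2}) (M : ℕ),
      ∃ c' : {c : (ℝ → ℝ) × Set ℝ // FrostmanDensity s c.1 c.2}, c'.1.2 ⊆ c.1.2 ∧
        ∀ x ∈ c'.1.2, ∃ p q : ℕ, M < q ∧ |x - (p : ℝ) / q| < (q : ℝ) ^ (-α) := by
    rintro ⟨c, hc⟩ M
    obtain ⟨g', K', h, hK, hx⟩ := hc.exists_refinement hα hs0 hs M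
    exact ⟨⟨(g', K'), h⟩, hK, hx⟩
  choose next hnext_sub hnext using hstep
  let c : ℕ → {c : (ℝ → ℝ) × Set ℝ // FrostmanDensity s c.1 c.2} := fun n =>
    Nat.rec ⟨(fun _ => 1, Icc 0 1), frostmanDensity_one hs1⟩ (fun k ih => next ih k) n
  have hc : ∀ k, c (k + 1) = next (c k) k := fun k => rfl
  set K : ℕ → Set ℝ := fun n => (c n).1.2 with hK
  choose μ hμK hμc hμ using fun n => (c n).2.exists_measure hs0
  have hKanti : Antitone K := antitone_nat_of_succ_le fun n => by
    simpa only [hK, hc] using hnext_sub (c n) n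
  have hKJ : (⋂ n, K n) ⊆ JSet α := by
    intro x hx
    rw [mem_iInter] at hx
    refine ⟨(c 0).2.subset (hx 0), fun hfin => ?_⟩
    obtain ⟨M, hM⟩ := (hfin.image Prod.snd).bddAbove
    have hxM : x ∈ (next (c M) M).1.2 := by
      rw [← hc]
      exact hx (M + 1)
    obtain ⟨p, q, hq, hpq⟩ := hnext (c M) M x hxM
    exact absurd (hM (mem_image_of_mem Prod.snd (show (p, q) ∈ _ from hpq))) (not_le.2 hq)
  have := hausdorffMeasure_iInter_ne_zero hs0 hKanti (fun n => (c n).2.isCompact) μ hμK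
    (by simp) ENNReal.ofNat_ne_top hμc hμ
  exact fun h0 => this (measure_mono_null hKJ h0)

lemma le_dimH_JSet {α : ℝ} (hα : 2 < α) : ENNReal.ofReal (2 / α) ≤ dimH (JSet α) := by
  refine le_of_forall_lt fun d hd => ?_
  obtain ⟨e, hde, he⟩ := exists_between hd
  lift e to NNReal using (he.trans ENNReal.ofReal_lt_top).ne
  have he0 : (0 : ℝ) < e := by exact_mod_cast (zero_le (a := d)).trans_lt hde
  have he' : (e : ℝ) < 2 / α := by
    rw [← ENNReal.ofReal_coe_nnreal] at he
    exact (ENNReal.ofReal_lt_ofReal_iff (div_pos two_pos (by linarith))).1 he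
  exact hde.trans_le (le_dimH_of_hausdorffMeasure_ne_zero
    (hausdorffMeasure_JSet_ne_zero hα he0 he'))

end LowerBound

/-- **Jarník–Besicovitch theorem.** For `α > 2`, `dim J(α) = 2/α`. -/
theorem dimH_JSet_eq (α : ℝ) (hα : 2 < α) :
    dimH (JSet α) = ENNReal.ofReal (2 / α) := by
  exact (dimH_JSet_le (by linarith)).antisymm (le_dimH_JSet hα)
end
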